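/- arXiv:1909.10412 — 4 statements merged into one kernel-verified Lean document; each statement's English description precedes it below -/
import Mathlib

section
/- Let X be a nonempty set, n ≥ 3, and let F : X^n → X be associative, quasitrivial on D^n_{n-1}, with |E_F| ≥ 3. Then every element x ∈ X \ E_F is an annihilator for the restriction of F to ({x} ∪ E_F)^n. Moreover, the restriction of F to (X \ E_F)^n is quasitrivial and has at most one neutral element. -/
variable {X : Type*}

/-- The result of substituting `F` applied to the `n` consecutive entries starting at
position `i` of the `(2n-1)`-tuple `x` (given as the first `2n-1` values of `x : ℕ → X`),
and then applying `F` to the resulting `n`-tuple. -/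
def naryCompAt (n : ℕ) (F : (Fin n → X) → X) (x : ℕ → X) (i : ℕ) : X :=
  F fun j => if (j : ℕ) < i then x j
    else if (j : ℕ) = i then F (fun k => x (i + (k : ℕ)))
    else x ((j : ℕ) + n - 1)

/-- `F` is an associative `n`-ary operation. -/
def NAryAssociative (n : ℕ) (F : (Fin n → X) → X) : Prop :=
  ∀ (x : ℕ → X) (i : ℕ), i + 1 ≤ n - 1 → naryCompAt n F x i = naryCompAt n F x (i + 1)

/-- `e` is a neutral element for the `n`-ary operation `F`: inserting the argument `a` at
any position `p`, with `e` at all the other positions, returns `a`. -/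
def NAryNeutral (n : ℕ) (F : (Fin n → X) → X) (e : X) : Prop :=
  ∀ (a : X) (p : Fin n), F (Function.update (fun _ => e) p a) = a

/-- The set `E_F` of neutral elements for `F`. -/
def naryNeutralSet (n : ℕ) (F : (Fin n → X) → X) : Set X :=
  {e | NAryNeutral n F e}

/-- `e` is a neutral element for the restriction of `F` to `S^n`. -/
def NAryNeutralOn (n : ℕ) (F : (Fin n → X) → X) (S : Set X) (e : X) : Prop :=
  e ∈ S ∧ ∀ a ∈ S, ∀ p : Fin n, F (Function.update (fun _ => e) p a) = a

/-- `iterOp G m x = G (x 0) (G (x 1) (⋯ (G (x (m-1)) (x m))⋯))`,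
the `m`-fold iterate of the binary operation `G`, applied to `m+1` arguments. -/
def iterOp (G : X → X → X) : ℕ → (ℕ → X) → X
  | 0, x => x 0
  | m + 1, x => G (x 0) (iterOp G m fun i => x (i + 1))

/-- The `n`-ary operation `F` is reducible to the binary operation `G`, i.e. `F` is the
`(n-1)`-fold iterate of `G`. -/
def NAryReducibleTo (n : ℕ) (F : (Fin n → X) → X) (G : X → X → X) : Prop :=
  ∀ x : ℕ → X, F (fun i : Fin n => x i) = iterOp G (n - 1) x

/-- `gPow G a m` is the `G`-product of `m + 1` copies of `a`. -/
def gPow (G : X → X → X) (a : X) : ℕ → X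
  | 0 => a
  | m + 1 => G a (gPow G a m)

/-- `(Y, G)` is an Abelian group whose exponent divides `m` (for `m ≥ 1`): `G` maps `Y × Y`
into `Y` and is commutative and associative on `Y`, and `Y` contains a neutral element `e`
for which every element of `Y` has an inverse and such that the `G`-product of `m` copies of
any element of `Y` equals `e`. -/
def IsAbelianGroupOfExpDvdOn (Y : Set X) (G : X → X → X) (m : ℕ) : Prop :=
  (∀ a ∈ Y, ∀ b ∈ Y, G a b ∈ Y) ∧
  (∀ a ∈ Y, ∀ b ∈ Y, G a b = G b a) ∧
  (∀ a ∈ Y, ∀ b ∈ Y, ∀ c ∈ Y, G (G a b) c = G a (G b c)) ∧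
  ∃ e ∈ Y, (∀ a ∈ Y, G e a = a) ∧ (∀ a ∈ Y, ∃ b ∈ Y, G a b = e) ∧
    (∀ a ∈ Y, gPow G a (m - 1) = e)

/-- The tuple `x` lies in `D^n_k`: at least `k` of its components are equal to each other. -/
def MemD (n k : ℕ) (x : Fin n → X) : Prop :=
  ∃ S : Finset (Fin n), k ≤ S.card ∧ ∀ i ∈ S, ∀ j ∈ S, x i = x j

/-- `F` is quasitrivial on `D^n_k`. -/
def NAryQuasitrivialOnD (n k : ℕ) (F : (Fin n → X) → X) : Prop :=
  ∀ x : Fin n → X, MemD n k x → F x ∈ Set.range x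

/-- `F` is quasitrivial on `S^n_k`, the set of tuples taking at most `k` distinct values. -/
def NAryQuasitrivialOnS (n k : ℕ) (F : (Fin n → X) → X) : Prop :=
  ∀ x : Fin n → X, (Set.range x).encard ≤ k → F x ∈ Set.range x

/-- `F` is quasitrivial. -/
def NAryQuasitrivial (n : ℕ) (F : (Fin n → X) → X) : Prop :=
  ∀ x : Fin n → X, F x ∈ Set.range x

/-- An associative `n`-ary operation with a neutral element is the `n`-fold product of a monoid. -/
theorem NAryAssociative.exists_monoid {n : ℕ} (hn : 2 ≤ n) {F : (Fin n → X) → X}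
    (hF : NAryAssociative n F) {e : X} (he : NAryNeutral n F e) :
    ∃ _ : Monoid X, ∀ y : Fin n → X, F y = (List.ofFn y).prod := by
  have comp_eq : ∀ (x : ℕ → X) (i : ℕ), i ≤ n - 1 → naryCompAt n F x i = naryCompAt n F x 0 := by
    intro x i
    induction i with
    | zero => intro; rfl
    | succ i ih => intro h; rw [← hF x i h, ih (by omega)]
  have neutral : ∀ (p : ℕ) (_ : p < n) (x : ℕ → X), (∀ i < n, i ≠ p → x i = e) →
      F (fun i => x i) = x p := by
    intro p hp x hx
    rw [← he (x p) ⟨p, hp⟩]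
    congr 1
    funext i
    by_cases h : i = ⟨p, hp⟩
    · subst h; simp
    · rw [Function.update_of_ne h]
      exact hx i i.2 fun h' => h (Fin.ext h')
  let G : X → X → X := fun a b =>
    F fun i => if (i : ℕ) = 0 then a else if (i : ℕ) = n - 1 then b else e
  let M : Monoid X :=
    { mul := G
      one := e
      mul_assoc := by
        intro a b c
        have h := comp_eq
          (fun i => if i = 0 then a else if i = n - 1 then b else if i = 2 * n - 2 then c else e)
          (n - 1) le_rfl
        change G (G a b) c = G a (G b c)
        refine Eq.trans ?_ (h.symm.trans ?_)
        · unfold naryCompAt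
          refine congrArg F (funext fun i => ?_)
          grind
        · unfold naryCompAt
          refine congrArg F (funext fun i => ?_)
          grind
      one_mul := fun a =>
        (neutral (n - 1) (by omega) (fun i => if i = 0 then e else if i = n - 1 then a else e)
          (by grind)).trans (by grind)
      mul_one := fun a =>
        (neutral 0 (by omega) (fun i => if i = 0 then a else if i = n - 1 then e else e)
          (by grind)).trans (by grind) }
  have mul_def : ∀ a b : X, a * b = G a b := fun _ _ => rfl
  have one_def : (1 : X) = e := rfl
  have prod_initial : ∀ (x : ℕ → X) (k : ℕ), k ≤ n →
      F (fun i => if (i : ℕ) < k then x i else e) = ((List.range k).map x).prod := by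
    intro x k
    induction k with
    | zero =>
      intro _
      simpa [one_def] using neutral 0 (by omega) (fun _ => e) (by simp)
    | succ k ih =>
      intro hk
      rw [List.prod_range_succ, ← ih (by omega), mul_def]
      have shift_last := comp_eq (fun i => if i < k then x i else if i = 2 * n - 2 then x k else e)
        (n - 1) le_rfl
      have shift_mid := comp_eq (fun i => if i < k then x i else if i = n - 1 then x k else e)
        k (by omega)
      have absorb_last : F (fun j : Fin n => if n - 1 + (j : ℕ) < k then x (n - 1 + j) else
          if n - 1 + (j : ℕ) = 2 * n - 2 then x k else e) = x k :=
        (neutral (n - 1) (by omega) (fun j => if n - 1 + j < k then x (n - 1 + j) else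
          if n - 1 + j = 2 * n - 2 then x k else e) (by grind)).trans (by grind)
      have absorb_mid : F (fun j : Fin n => if k + (j : ℕ) < k then x (k + j) else
          if k + (j : ℕ) = n - 1 then x k else e) = x k :=
        (neutral (n - 1 - k) (by omega) (fun j => if k + j < k then x (k + j) else
          if k + j = n - 1 then x k else e) (by grind)).trans (by grind)
      have absorb_right := neutral 0 (by omega) (fun j => if j = 0 then
        F (fun i : Fin n => if (i : ℕ) < k then x i else if (i : ℕ) = n - 1 then x k else e)
        else e) (by grind)
      unfold naryCompAt at shift_last shift_mid
      simp only [absorb_last] at shift_last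
      simp only [absorb_mid] at shift_mid
      calc _ = _ := ?_
        _ = _ := shift_mid
        _ = _ := ?_
        _ = _ := absorb_right
        _ = _ := ?_
        _ = _ := shift_last
        _ = _ := ?_
      · refine congrArg F (funext fun i => ?_)
        grind
      · refine congrArg F (funext fun i => ?_)
        grind
      · refine Eq.trans (if_pos rfl) (congrArg F (funext fun i => ?_))
        grind
      · refine congrArg F (funext fun i => ?_)
        have inner : F (fun j : Fin n => if 0 + (j : ℕ) < k then x (0 + j) else
            if 0 + (j : ℕ) = 2 * n - 2 then x k else e) =
            F fun j => if (j : ℕ) < k then x j else e :=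
          congrArg F (funext fun j => by clear * - hn; grind)
        simp only [inner]
        clear * - hn hk
        grind
  refine ⟨M, fun y => ?_⟩
  have h := prod_initial (fun i => if hi : i < n then y ⟨i, hi⟩ else e) n le_rfl
  simp only [Fin.is_lt, dite_true, if_true, Fin.eta] at h
  rw [h]
  congr 1
  apply List.ext_getElem <;> simp +contextual

/-- The product of a constant tuple with one entry replaced. -/
theorem List.prod_ofFn_update_const {M : Type*} [Monoid M] {n : ℕ} (a b : M) (p : Fin n) :
    (List.ofFn (Function.update (fun _ => a) p b)).prod = a ^ (p : ℕ) * b * a ^ (n - 1 - p) := by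
  have h : List.ofFn (Function.update (fun _ => a) p b) = (List.replicate n a).set p b := by
    apply List.ext_getElem
    · simp
    · intro i h₁ h₂
      simp [List.getElem_set, Function.update_apply, Fin.ext_iff, eq_comm]
  rw [h, List.prod_set]
  simp [Nat.sub_sub, Nat.add_comm, p.2.le]

theorem List.mul_prod_eq_left {M : Type*} [Monoid M] {x : M} {l : List M}
    (h : ∀ a ∈ l, x * a = x) : x * l.prod = x := by
  induction l with
  | nil => simp
  | cons a l ih =>
    rw [List.prod_cons, ← mul_assoc, h a (by simp), ih fun b hb => h b (by simp [hb])]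

theorem List.prod_mul_eq_right {M : Type*} [Monoid M] {x : M} {l : List M}
    (h : ∀ a ∈ l, a * x = x) : l.prod * x = x := by
  induction l with
  | nil => simp
  | cons a l ih =>
    rw [List.prod_cons, mul_assoc, ih fun b hb => h b (by simp [hb]), h a (by simp)]

theorem List.prod_mem_of_mul_eq_or {M : Type*} [Monoid M] {S : Set M}
    (hS : ∀ a ∈ S, ∀ b ∈ S, a * b = a ∨ a * b = b) {l : List M} (hl : l ≠ [])
    (h : ∀ a ∈ l, a ∈ S) : l.prod ∈ l := by
  induction l with
  | nil => exact absurd rfl hl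
  | cons a l ih =>
    rcases eq_or_ne l [] with rfl | hl'
    · simp
    · have hp := ih hl' fun b hb => h b (by simp [hb])
      rw [List.prod_cons]
      rcases hS a (h a (by simp)) l.prod (h _ (by simp [hp])) with h' | h'
      · simp [h']
      · rw [h']; simp [hp]

/-- Quasitriviality on `D^n_{n-1}`, evaluated on constant tuples with one entry replaced. -/
theorem NAryQuasitrivialOnD.update_const {n : ℕ} {F : (Fin n → X) → X}
    (hQ : NAryQuasitrivialOnD n (n - 1) F) (a b : X) (p : Fin n) :
    F (Function.update (fun _ => a) p b) = a ∨ F (Function.update (fun _ => a) p b) = b := by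
  obtain ⟨i, hi⟩ := hQ (Function.update (fun _ => a) p b)
    ⟨Finset.univ.erase p, by simp, fun i hi j hj => by
      simp [Function.update_of_ne (Finset.ne_of_mem_erase hi),
        Function.update_of_ne (Finset.ne_of_mem_erase hj)]⟩
  rw [← hi, Function.update_apply]
  split_ifs <;> simp

/-- If `F` is associative, quasitrivial on `D^n_{n-1}`, and `|E_F| ≥ 3`, then every
`x ∉ E_F` is an annihilator for `F|_{({x} ∪ E_F)^n}`; moreover `F|_{(X \ E_F)^n}` is
quasitrivial and has at most one neutral element. -/
theorem stmt_12 {X : Type*} [Nonempty X] (n : ℕ) (hn : 3 ≤ n)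
    (F : (Fin n → X) → X) (hF : NAryAssociative n F)
    (hQ : NAryQuasitrivialOnD n (n - 1) F)
    (hE : 3 ≤ (naryNeutralSet n F).encard) :
    (∀ x ∉ naryNeutralSet n F,
      ∀ y : Fin n → X, (∀ i, y i ∈ insert x (naryNeutralSet n F)) →
        (∃ i, y i = x) → F y = x) ∧
    (∀ y : Fin n → X, (∀ i, y i ∉ naryNeutralSet n F) → F y ∈ Set.range y) ∧
    {e | NAryNeutralOn n F (naryNeutralSet n F)ᶜ e}.Subsingleton := by
  obtain ⟨e, he⟩ : (naryNeutralSet n F).Nonempty := by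
    rw [← Set.encard_pos]
    exact lt_of_lt_of_le (by norm_num) hE
  obtain ⟨_, hM⟩ := hF.exists_monoid (by omega) he
  have neutral_iff : ∀ a, a ∈ naryNeutralSet n F ↔
      ∀ (x : X) (p : Fin n), a ^ (p : ℕ) * x * a ^ (n - 1 - p) = x := by
    intro a
    simp only [naryNeutralSet, Set.mem_ofPred_eq, NAryNeutral, hM, List.prod_ofFn_update_const]
  have quasi : ∀ (a b : X) (k : ℕ), k < n →
      a ^ k * b * a ^ (n - 1 - k) = a ∨ a ^ k * b * a ^ (n - 1 - k) = b := by
    intro a b k hk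
    simpa only [hM, List.prod_ofFn_update_const] using hQ.update_const a b ⟨k, hk⟩
  have pow_of_mem : ∀ a ∈ naryNeutralSet n F, a ^ (n - 1) = 1 := by
    intro a ha
    simpa using (neutral_iff a).1 ha 1 ⟨0, by omega⟩
  have mem_of_pow : ∀ a : X, a ^ (n - 1) = 1 → a ∈ naryNeutralSet n F := by
    intro a ha
    rw [neutral_iff]
    intro x p
    have hp : n - 1 - (p : ℕ) + p = n - 1 := by omega
    rcases quasi a x p p.2 with h | h
    · have hx : x = a := by
        calc x = a ^ (n - 1 - (p : ℕ) + p) * x * a ^ (n - 1 - (p : ℕ) + p) := by simp [hp, ha]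
          _ = a ^ (n - 1 - (p : ℕ)) * (a ^ (p : ℕ) * x * a ^ (n - 1 - (p : ℕ))) * a ^ (p : ℕ) := by
            simp only [pow_add, mul_assoc]
          _ = a ^ (n - 1 - (p : ℕ) + p) * a := by
            rw [h, mul_assoc, ← pow_succ', pow_succ, ← mul_assoc, ← pow_add]
          _ = a := by simp [hp, ha]
      rw [h, hx]
    · exact h
  have pow_pred : ∀ x ∉ naryNeutralSet n F, x ^ (n - 1) = x := by
    intro x hx
    have h := quasi x 1 0 (by omega)
    simp only [pow_zero, one_mul, Nat.sub_zero] at h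
    exact h.resolve_right fun h' => hx (mem_of_pow x h')
  have idem : ∀ x ∉ naryNeutralSet n F, x * x = x := by
    intro x hx
    have h := quasi x x 0 (by omega)
    simpa [pow_pred x hx] using h
  have quasi_mul : ∀ x ∉ naryNeutralSet n F, ∀ y, x * y = x ∨ x * y = y := by
    intro x hx y
    simpa [pow_pred x hx] using quasi x y (n - 1) (by omega)
  have quasi_mul' : ∀ x ∉ naryNeutralSet n F, ∀ y, y * x = x ∨ y * x = y := by
    intro x hx y
    simpa [pow_pred x hx] using quasi x y 0 (by omega)
  have one_mem : (1 : X) ∈ naryNeutralSet n F := mem_of_pow 1 (one_pow _)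
  have hsplit : n - 1 = n - 2 + 1 := by omega
  have mul_neutral : ∀ x ∉ naryNeutralSet n F, ∀ a ∈ naryNeutralSet n F, x * a = x := by
    intro x hx a ha
    refine (quasi_mul x hx a).resolve_right fun h => hx ?_
    have : x = 1 := by
      have h₁ := pow_of_mem a ha
      rw [hsplit, pow_succ'] at h₁
      rw [← h₁, ← mul_one x, ← h₁, ← mul_assoc, h]
    exact this ▸ one_mem
  have neutral_mul : ∀ x ∉ naryNeutralSet n F, ∀ a ∈ naryNeutralSet n F, a * x = x := by
    intro x hx a ha
    refine (quasi_mul' x hx a).resolve_right fun h => hx ?_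
    have : x = 1 := by
      have h₁ := pow_of_mem a ha
      rw [hsplit, pow_succ] at h₁
      rw [← h₁, ← one_mul x, ← h₁, mul_assoc, h]
    exact this ▸ one_mem
  refine ⟨?_, ?_, ?_⟩
  · rintro x hx y hy ⟨i, hi⟩
    have hmem : ∀ a ∈ List.ofFn y, x * a = x ∧ a * x = x := by
      intro a ha
      obtain ⟨j, rfl⟩ := (List.mem_ofFn' _ _).1 ha
      rcases hy j with h | h
      · rw [h]; exact ⟨idem x hx, idem x hx⟩
      · exact ⟨mul_neutral x hx _ h, neutral_mul x hx _ h⟩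
    have hxy : x ∈ List.ofFn y := (List.mem_ofFn' _ _).2 ⟨i, hi⟩
    obtain ⟨l₁, l₂, hl⟩ := List.append_of_mem hxy
    rw [hl] at hmem
    rw [hM, hl, List.prod_append, List.prod_cons,
      List.mul_prod_eq_left fun a ha => (hmem a (by simp [ha])).1,
      List.prod_mul_eq_right fun a ha => (hmem a (by simp [ha])).2]
  · intro y hy
    rw [hM]
    refine (List.mem_ofFn' _ _).1 (List.prod_mem_of_mul_eq_or (S := (naryNeutralSet n F)ᶜ)
      (fun a ha b _ => quasi_mul a ha b) ?_ ?_)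
    · simp; omega
    · intro a ha
      obtain ⟨j, rfl⟩ := (List.mem_ofFn' _ _).1 ha
      exact hy j
  · rintro a ⟨ha, haN⟩ b ⟨hb, hbN⟩
    have h₁ := haN b hb ⟨n - 1, by omega⟩
    have h₂ := hbN a ha ⟨0, by omega⟩
    simp only [hM, List.prod_ofFn_update_const] at h₁ h₂
    simp only [Nat.sub_self, Nat.sub_zero, pow_zero, one_mul, mul_one, pow_pred a ha,
      pow_pred b hb] at h₁ h₂
    exact h₂.symm.trans h₁
end

section
/- Let X be a nonempty set, n ≥ 3, and suppose there exists an associative operation X^n → X that is quasitrivial on D^n_{n-1} but not quasitrivial. Then an associative operation F : X^n → X is quasitrivial on D^n_{n-1} but not quasitrivial if and only if there exists a unique subset Y ⊆ X with |Y| ≥ 3 such that: (a) the restriction of F to Y^n is the n-ary extension of a binary operation G on Y making (Y,G) an Abelian group whose exponent divides n-1; (b) the restriction of F to (X \ Y)^n is quasitrivial and has at most one neutral element; (c) every x ∈ X \ Y is an annihilator for the restriction of F to ({x} ∪ Y)^n. Moreover, in that case Y = E_F. -/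
variable {X : Type*}

/-- Conditions (a), (b), (c) of Theorem 1.8, together with `|Y| ≥ 3`, for a subset `Y`:
(a) `(Y, F|_{Y^n})` is the `n`-ary extension of an Abelian group whose exponent divides
`n - 1`; (b) `F|_{(X \ Y)^n}` is quasitrivial and has at most one neutral element;
(c) any `x ∈ X \ Y` is an annihilator for `F|_{({x} ∪ Y)^n}`. -/
def Cond13 {X : Type*} (n : ℕ) (F : (Fin n → X) → X) (Y : Set X) : Prop :=
  3 ≤ Y.encard ∧
  (∃ G : X → X → X, IsAbelianGroupOfExpDvdOn Y G (n - 1) ∧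
    ∀ x : ℕ → X, (∀ i < n, x i ∈ Y) →
      F (fun i : Fin n => x i) = iterOp G (n - 1) x) ∧
  ((∀ y : Fin n → X, (∀ i, y i ∈ Yᶜ) → F y ∈ Set.range y) ∧
    {e | NAryNeutralOn n F Yᶜ e}.Subsingleton) ∧
  (∀ x ∈ Yᶜ, ∀ y : Fin n → X, (∀ i, y i ∈ insert x Y) → (∃ i, y i = x) → F y = x)

theorem naryCompAt_eq_zero {n : ℕ} {F : (Fin n → X) → X} (hF : NAryAssociative n F)
    (x : ℕ → X) {i : ℕ} (hi : i ≤ n - 1) : naryCompAt n F x i = naryCompAt n F x 0 := by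
  induction i with
  | zero => rfl
  | succ i ih => rw [← hF x i hi, ih (by omega)]

section Words

variable [Inhabited X]

/-- The value of `F` at the first `n` entries of a list. -/
def naryOnList (n : ℕ) (F : (Fin n → X) → X) (l : List X) : X :=
  F fun i => l.getD i default

/-- The value obtained from a list by replacing `k` times its first `n` entries with their
`F`-product, and then taking the first entry. -/
def naryFold (n : ℕ) (F : (Fin n → X) → X) : ℕ → List X → X
  | 0, l => l.headD default
  | k + 1, l => naryFold n F k (naryOnList n F (l.take n) :: l.drop n)

theorem naryFold_succ_append {n : ℕ} {F : (Fin n → X) → X} {p : List X} (hp : p.length = n)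
    (k : ℕ) (q : List X) :
    naryFold n F (k + 1) (p ++ q) = naryFold n F k (naryOnList n F p :: q) := by
  rw [naryFold, List.take_left' hp, List.drop_left' hp]

theorem naryOnList_ofFn {n : ℕ} {F : (Fin n → X) → X} (x : Fin n → X) :
    naryOnList n F (List.ofFn x) = F x := by
  unfold naryOnList
  congr 1
  funext i
  rw [List.getD_eq_getElem _ _ (by simp), List.getElem_ofFn]

theorem naryCompAt_getD {n : ℕ} {F : (Fin n → X) → X} (p w q : List X)
    (hw : w.length = n) :
    naryCompAt n F (fun j => (p ++ w ++ q).getD j default) p.length =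
      naryOnList n F (p ++ naryOnList n F w :: q) := by
  unfold naryCompAt naryOnList
  congr 1
  funext j
  have hj := j.isLt
  dsimp only
  split_ifs with h1 h2
  · rw [List.append_assoc, List.getD_append _ _ _ _ h1, List.getD_append _ _ _ _ h1]
  · rw [List.getD_append_right _ _ _ _ h2.ge, h2, Nat.sub_self, List.getD_cons_zero]
    congr 1
    funext k
    have hk := k.isLt
    rw [List.append_assoc, List.getD_append_right _ _ _ _ (by omega),
      List.getD_append _ _ _ _ (by omega)]
    congr 1
    omega
  · rw [List.getD_append_right _ _ _ _ (by simp; omega),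
      List.getD_append_right _ _ _ _ (by omega)]
    obtain ⟨d, hd⟩ : ∃ d, (j : ℕ) - p.length = d + 1 := ⟨(j : ℕ) - p.length - 1, by omega⟩
    rw [hd, List.getD_cons_succ]
    congr 1
    simp
    omega

theorem naryOnList_assoc {n : ℕ} {F : (Fin n → X) → X} (hF : NAryAssociative n F)
    {p w₁ w₂ q : List X} (hp : p.length ≤ n - 1) (hpw : p.length + w₁.length = n)
    (hw : w₁.length + w₂.length = n) :
    naryOnList n F (p ++ naryOnList n F (w₁ ++ w₂) :: q) =
      naryOnList n F (naryOnList n F (p ++ w₁) :: (w₂ ++ q)) := by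
  have h1 := naryCompAt_getD (F := F) p (w₁ ++ w₂) q (by simpa using hw)
  have h2 := naryCompAt_getD (F := F) [] (p ++ w₁) (w₂ ++ q) (by simpa using hpw)
  rw [naryCompAt_eq_zero hF _ hp] at h1
  simp only [List.nil_append, List.length_nil, List.append_assoc] at h1 h2
  rw [← h1, ← h2]

theorem naryFold_append {m : ℕ} (hm : 1 ≤ m) {F : (Fin (m + 1) → X) → X}
    (hF : NAryAssociative (m + 1) F) (k : ℕ) (p w q : List X) (hw : w.length = m + 1)
    (hk : p.length + q.length = k * m) :
    naryFold (m + 1) F (k + 1) (p ++ w ++ q) =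
      naryFold (m + 1) F k (p ++ naryOnList (m + 1) F w :: q) := by
  induction k generalizing p with
  | zero =>
    obtain rfl : p = [] := List.length_eq_zero_iff.1 (by omega)
    obtain rfl : q = [] := List.length_eq_zero_iff.1 (by omega)
    simp [naryFold, List.take_of_length_le hw.le]
  | succ k ih =>
    rcases Nat.lt_or_ge p.length (m + 1) with hp | hp
    · rcases Nat.eq_zero_or_pos p.length with h0 | h0
      · obtain rfl : p = [] := List.length_eq_zero_iff.1 h0
        rw [List.nil_append, List.nil_append, naryFold_succ_append hw]
      · obtain ⟨q₁, q₂, rfl, hq⟩ : ∃ q₁ q₂, q = q₁ ++ q₂ ∧ q₁.length = m - p.length :=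
          ⟨_, _, (List.take_append_drop (m - p.length) q).symm, by
            rw [List.length_take]; rw [Nat.succ_mul] at hk; omega⟩
        obtain ⟨w₁, w₂, rfl, hw₁⟩ : ∃ w₁ w₂, w = w₁ ++ w₂ ∧ w₁.length = m + 1 - p.length :=
          ⟨_, _, (List.take_append_drop (m + 1 - p.length) w).symm, by
            rw [List.length_take]; omega⟩
        rw [List.length_append] at hw
        have e1 : p ++ (w₁ ++ w₂) ++ (q₁ ++ q₂) = (p ++ w₁) ++ (w₂ ++ q₁ ++ q₂) := by simp
        have l1 : (p ++ w₁).length = m + 1 := by simp; omega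
        have e2 : ∀ a, p ++ a :: (q₁ ++ q₂) = (p ++ a :: q₁) ++ q₂ := by simp
        have l2 : ∀ a, (p ++ a :: q₁).length = m + 1 := by simp; omega
        have e3 : ∀ a, a :: (w₂ ++ q₁ ++ q₂) = (a :: (w₂ ++ q₁)) ++ q₂ := by simp
        have l3 : ∀ a, (a :: (w₂ ++ q₁)).length = m + 1 := by simp; omega
        rw [e1, naryFold_succ_append l1, e3, naryFold_succ_append (l3 _), e2,
          naryFold_succ_append (l2 _),
          naryOnList_assoc hF (by omega) (by omega) hw]
    · obtain ⟨p₁, p₂, rfl, hp₁⟩ : ∃ p₁ p₂, p = p₁ ++ p₂ ∧ p₁.length = m + 1 :=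
        ⟨_, _, (List.take_append_drop (m + 1) p).symm, by rw [List.length_take]; omega⟩
      have := ih (naryOnList (m + 1) F p₁ :: p₂) (by
        rw [Nat.succ_mul, List.length_append] at hk
        rw [List.length_cons]; omega)
      simp only [List.append_assoc, List.cons_append] at this ⊢
      rw [naryFold_succ_append hp₁, naryFold_succ_append hp₁, this]

/-- The full `F`-product of a list. -/
def naryEval (m : ℕ) (F : (Fin (m + 1) → X) → X) (l : List X) : X :=
  naryFold (m + 1) F ((l.length - 1) / m) l

theorem naryEval_append {m : ℕ} (hm : 2 ≤ m) {F : (Fin (m + 1) → X) → X}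
    (hF : NAryAssociative (m + 1) F) (p w q : List X) (hw : w.length = m + 1)
    (hk : p.length + w.length + q.length ≡ 1 [MOD m]) :
    naryEval m F (p ++ w ++ q) = naryEval m F (p ++ naryOnList (m + 1) F w :: q) := by
  have hd : m ∣ p.length + q.length := by
    have : p.length + w.length + q.length = (p.length + q.length + m) + 1 := by omega
    rw [this] at hk
    have h0 : p.length + q.length + m ≡ 0 [MOD m] := Nat.ModEq.add_right_cancel' 1 hk
    simpa using (Nat.modEq_zero_iff_dvd.1 h0)
  obtain ⟨k, hk⟩ := hd
  unfold naryEval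
  have h1 : ((p ++ w ++ q).length - 1) / m = k + 1 := by
    have : (p ++ w ++ q).length - 1 = m * (k + 1) := by
      simp only [List.length_append, Nat.mul_succ]; omega
    rw [this, Nat.mul_div_cancel_left _ (by omega)]
  have h2 : ((p ++ naryOnList (m + 1) F w :: q).length - 1) / m = k := by
    have : (p ++ naryOnList (m + 1) F w :: q).length - 1 = m * k := by
      simp only [List.length_append, List.length_cons]; omega
    rw [this, Nat.mul_div_cancel_left _ (by omega)]
  rw [h1, h2]
  exact naryFold_append (by omega) hF k p w q hw (by rw [hk, mul_comm])

/-- The syntactic congruence of the `F`-product on the free monoid. -/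
def naryCon (m : ℕ) (F : (Fin (m + 1) → X) → X) : Con (FreeMonoid X) where
  r u v := u.toList.length ≡ v.toList.length [MOD m] ∧
    ∀ p q : List X, p.length + u.toList.length + q.length ≡ 1 [MOD m] →
      naryEval m F (p ++ u.toList ++ q) = naryEval m F (p ++ v.toList ++ q)
  iseqv := by
    refine ⟨fun u => ⟨rfl, fun _ _ _ => rfl⟩, fun ⟨h, h'⟩ => ⟨h.symm, fun p q hpq => ?_⟩,
      fun ⟨h, h'⟩ ⟨g, g'⟩ => ⟨h.trans g, fun p q hpq => ?_⟩⟩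
    · exact (h' p q (((h.add_left _).add_right _).trans hpq)).symm
    · exact (h' p q hpq).trans (g' p q (((h.symm.add_left _).add_right _).trans hpq))
  mul' := by
    rintro u v u' v' ⟨h, h'⟩ ⟨g, g'⟩
    simp only [FreeMonoid.toList_mul, List.length_append]
    refine ⟨h.add g, fun p q hpq => ?_⟩
    have h1 := h' p (u'.toList ++ q) (by
      simpa only [List.length_append, add_assoc] using hpq)
    have h2 := g' (p ++ v.toList) q (by
      rw [List.length_append]
      refine Nat.ModEq.trans ?_ hpq
      rw [← add_assoc p.length]
      exact ((h.symm.add_left _).add_right _).add_right _)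
    simp only [List.append_assoc] at h1 h2 ⊢
    exact h1.trans h2

end Words

/-- Every `n`-ary semigroup embeds into a monoid whose product extends the operation. -/
theorem exists_monoid_of_naryAssociative.{u} {X : Type u} [Nonempty X] {m : ℕ} (hm : 2 ≤ m)
    {F : (Fin (m + 1) → X) → X} (hF : NAryAssociative (m + 1) F) :
    ∃ (M : Type u) (_ : Monoid M) (ι : X → M), Function.Injective ι ∧
      ∀ x : Fin (m + 1) → X, (List.ofFn fun i => ι (x i)).prod = ι (F x) := by
  inhabit X
  let φ : FreeMonoid X →* (naryCon m F).Quotient := (naryCon m F).mk'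
  refine ⟨(naryCon m F).Quotient, inferInstance, fun x => φ (FreeMonoid.of x), ?_, ?_⟩
  · intro a b hab
    have h := ((naryCon m F).eq.1 hab).2 [] [] (by simp; rfl)
    simpa [naryEval, naryFold] using h
  · intro x
    have h (l : List X) : (l.map fun a => φ (FreeMonoid.of a)).prod =
        φ (FreeMonoid.ofList l) := by
      induction l with
      | nil => simp
      | cons a l ih => rw [List.map_cons, List.prod_cons, ih, FreeMonoid.ofList_cons, map_mul]
    have := h (List.ofFn x)
    rw [List.map_ofFn, Function.comp_def] at this
    rw [this]
    refine (naryCon m F).eq.2 ⟨?_, fun p q hpq => ?_⟩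
    · simp [Nat.ModEq]
    · have := naryEval_append hm hF p (List.ofFn x) q (by simp) (by simpa using hpq)
      simpa only [naryOnList_ofFn, List.append_assoc, List.cons_append, List.nil_append,
        FreeMonoid.toList_ofList, FreeMonoid.toList_of] using this

/-- `ι` embeds `X` into a monoid so that `X` is closed under products of `m + 1` elements, and
the product of `m` copies of `a` and one copy of `b`, in any order, is `a` or `b`. -/
structure IsQuasitrivialEmbedding {M : Type*} [Monoid M] (m : ℕ) (ι : X → M) : Prop where
  two_le : 2 ≤ m
  injective : Function.Injective ι
  closed : ∀ l : List X, l.length = m + 1 → ∃ c, ι c = (l.map ι).prod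
  quasi : ∀ (a b : X) (i j : ℕ), i + j = m → ι a ^ i * ι b * ι a ^ j = ι a ∨
    ι a ^ i * ι b * ι a ^ j = ι b

namespace IsQuasitrivialEmbedding

variable {M : Type*} [Monoid M] {m : ℕ} {ι : X → M} {a b c d : X}

theorem pow_mul_self (h : IsQuasitrivialEmbedding m ι) (a : X) : ι a ^ m * ι a = ι a := by
  simpa using h.quasi a a m 0 rfl

theorem self_mul_pow (h : IsQuasitrivialEmbedding m ι) (a : X) : ι a * ι a ^ m = ι a := by
  rw [← pow_succ', pow_succ, h.pow_mul_self]

theorem self_mul_pow_sub (h : IsQuasitrivialEmbedding m ι) (a : X) :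
    ι a * ι a ^ (m - 1) = ι a ^ m :=
  mul_pow_sub_one (by have := h.two_le; omega) _

theorem pow_sub_mul_self (h : IsQuasitrivialEmbedding m ι) (a : X) :
    ι a ^ (m - 1) * ι a = ι a ^ m :=
  pow_sub_one_mul (by have := h.two_le; omega) _

theorem pow_mul_pow_self (h : IsQuasitrivialEmbedding m ι) (a : X) :
    ι a ^ m * ι a ^ m = ι a ^ m := by
  nth_rw 2 [← h.self_mul_pow_sub]
  rw [← mul_assoc, h.pow_mul_self, h.self_mul_pow_sub]

theorem pow_mul_or (h : IsQuasitrivialEmbedding m ι) (a b : X) :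
    ι a ^ m * ι b = ι a ∨ ι a ^ m * ι b = ι b := by
  simpa using h.quasi a b m 0 rfl

theorem mul_pow_or (h : IsQuasitrivialEmbedding m ι) (a b : X) :
    ι b * ι a ^ m = ι a ∨ ι b * ι a ^ m = ι b := by
  simpa using h.quasi a b 0 m (zero_add m)

/-- Two elements either have the same idempotent power, or one of them absorbs the other. -/
theorem trichotomy (h : IsQuasitrivialEmbedding m ι) (a b : X) :
    ι a ^ m = ι b ^ m ∨ (ι a * ι b = ι a * ι a ∧ ι a ^ m * ι b ^ m = ι a ^ m) ∨
      (ι a * ι b = ι b * ι b ∧ ι a ^ m * ι b ^ m = ι b ^ m) := by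
  have key1 (hl : ι a ^ m * ι b = ι b) : ι a ^ m * ι b ^ m = ι b ^ m := by
    rw [← h.self_mul_pow_sub b, ← mul_assoc, hl]
  have key2 (hl : ι a * ι b ^ m = ι a) : ι a ^ m * ι b ^ m = ι a ^ m := by
    rw [← h.pow_sub_mul_self a, mul_assoc, hl]
  rcases h.pow_mul_or a b with h1 | h1
  · have h2 : ι a * ι b ^ m = ι a := by rw [← h1, mul_assoc, h.self_mul_pow]
    refine Or.inr (Or.inl ⟨?_, key2 h2⟩)
    conv_lhs => rw [← h.self_mul_pow a, mul_assoc, h1]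
  · rcases h.mul_pow_or b a with h2 | h2
    · refine Or.inr (Or.inr ⟨?_, key1 h1⟩)
      conv_lhs => rw [← h.pow_mul_self b, ← mul_assoc, h2]
    · exact Or.inl ((key2 h2).symm.trans (key1 h1))

theorem mul_comm_of_pow_eq (h : IsQuasitrivialEmbedding m ι) (hab : ι a ^ m = ι b ^ m) :
    ι a * ι b = ι b * ι a := by
  rcases h.quasi a b 1 (m - 1) (by have := h.two_le; omega) with h1 | h1
  · rw [pow_one] at h1
    have h2 : ι a * ι b = ι a * ι a := by
      have := congrArg (· * ι a) h1
      simp only [mul_assoc] at this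
      rwa [h.pow_sub_mul_self, hab, h.self_mul_pow] at this
    have h3 : ι b = ι a := by
      calc ι b = ι a ^ (m - 1) * (ι a * ι b) := by
            rw [← mul_assoc, h.pow_sub_mul_self, hab, h.pow_mul_self]
        _ = ι a := by rw [h2, ← mul_assoc, h.pow_sub_mul_self, h.pow_mul_self]
    rw [h3]
  · have := congrArg (· * ι a) h1
    simp only [pow_one, mul_assoc] at this
    rwa [h.pow_sub_mul_self, hab, h.self_mul_pow] at this

/-- The idempotent power shared by two distinct elements is a left identity. -/
theorem pow_mul_of_ne (h : IsQuasitrivialEmbedding m ι) (hab : ι a ^ m = ι b ^ m)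
    (hne : a ≠ b) (c : X) : ι a ^ m * ι c = ι c := by
  rcases h.pow_mul_or a c with h1 | h1
  · rcases h.pow_mul_or b c with h2 | h2
    · rw [← hab, h1] at h2
      exact absurd (h.injective h2) hne
    · rw [hab, h2]
  · exact h1

theorem mul_pow_of_ne (h : IsQuasitrivialEmbedding m ι) (hab : ι a ^ m = ι b ^ m)
    (hne : a ≠ b) (c : X) : ι c * ι a ^ m = ι c := by
  rcases h.mul_pow_or a c with h1 | h1
  · rcases h.mul_pow_or b c with h2 | h2
    · rw [← hab, h1] at h2
      exact absurd (h.injective h2) hne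
    · rw [hab, h2]
  · exact h1

theorem pow_eq_of_identity (h : IsQuasitrivialEmbedding m ι) (hac : ι a ^ m * ι c = ι c)
    (hca : ι a * ι c ^ m = ι a) : ι a ^ m = ι c ^ m := by
  calc ι a ^ m = ι a ^ m * ι c ^ m := by
        rw [← h.pow_sub_mul_self a, mul_assoc, hca]
    _ = ι c ^ m := by
        rw [← h.self_mul_pow_sub c, ← mul_assoc, hac]

theorem mul_eq_of_pow_ne (h : IsQuasitrivialEmbedding m ι) (hab : ι a ^ m = ι b ^ m)
    (hne : a ≠ b) (hc : ι c ^ m ≠ ι a ^ m) :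
    ι a * ι c = ι c * ι c ∧ ι c * ι a = ι c * ι c := by
  have h1 : ι a ^ m * ι c ^ m = ι c ^ m := by
    rw [← h.self_mul_pow_sub c, ← mul_assoc, h.pow_mul_of_ne hab hne]
  have h2 : ι c ^ m * ι a ^ m = ι c ^ m := by
    rw [← h.pow_sub_mul_self c, mul_assoc, h.mul_pow_of_ne hab hne]
  constructor
  · rcases h.trichotomy a c with h3 | h3 | h3
    · exact absurd h3.symm hc
    · exact absurd (h1.symm.trans h3.2) hc
    · exact h3.1
  · rcases h.trichotomy c a with h3 | h3 | h3
    · exact absurd h3 hc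
    · exact h3.1
    · exact absurd (h2.symm.trans h3.2) hc

theorem commute_prod (h : IsQuasitrivialEmbedding m ι) {l : List X}
    (hl : ∀ d ∈ l, ι d ^ m = ι a ^ m) : Commute (ι a) (l.map ι).prod := by
  refine Commute.list_prod_right _ _ fun y hy => ?_
  obtain ⟨d, hd, rfl⟩ := List.mem_map.1 hy
  exact h.mul_comm_of_pow_eq (hl d hd).symm

theorem prod_pow (h : IsQuasitrivialEmbedding m ι) {l : List X} (hl : l ≠ [])
    (hla : ∀ d ∈ l, ι d ^ m = ι a ^ m) : (l.map ι).prod ^ m = ι a ^ m := by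
  induction l with
  | nil => exact absurd rfl hl
  | cons x l ih =>
    have hx := hla x List.mem_cons_self
    have hl' : ∀ d ∈ l, ι d ^ m = ι a ^ m := fun d hd => hla d (List.mem_cons_of_mem _ hd)
    rcases eq_or_ne l [] with rfl | hne
    · simpa using hx
    · rw [List.map_cons, List.prod_cons,
        (h.commute_prod fun d hd => (hl' d hd).trans hx.symm).mul_pow, ih hne hl', hx,
        h.pow_mul_pow_self]

/-- Every product equals a product of the same number of factors, chosen among the original
ones, that all share their idempotent power. -/
theorem exists_list (h : IsQuasitrivialEmbedding m ι) {l : List X} (hl : l ≠ []) :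
    ∃ l' : List X, l'.length = l.length ∧ l' ⊆ l ∧ (l'.map ι).prod = (l.map ι).prod ∧
      ∃ c ∈ l', ∀ d ∈ l', ι d ^ m = ι c ^ m := by
  induction l with
  | nil => exact absurd rfl hl
  | cons x l ih =>
    rcases eq_or_ne l [] with rfl | hne
    · exact ⟨[x], rfl, fun _ h => h, rfl, x, by simp, by simp⟩
    obtain ⟨t, hlen, hsub, hprod, c, hc, hcl⟩ := ih hne
    rw [List.map_cons, List.prod_cons, ← hprod]
    rcases h.trichotomy x c with h1 | h1 | h1
    · refine ⟨x :: t, by simp [hlen], List.cons_subset_cons x hsub, by simp, c, by simp [hc], ?_⟩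
      rintro d (_ | ⟨_, hd⟩)
      exacts [h1, hcl d hd]
    · by_cases hxc : ι x ^ m = ι c ^ m
      · refine ⟨x :: t, by simp [hlen], List.cons_subset_cons x hsub, by simp, c, by simp [hc], ?_⟩
        rintro d (_ | ⟨_, hd⟩)
        exacts [hxc, hcl d hd]
      refine ⟨List.replicate (t.length + 1) x, by simp [hlen], ?_, ?_, x, by simp, ?_⟩
      · intro d hd
        simp [List.eq_of_mem_replicate hd]
      · have key : ∀ s : List X, (∀ d ∈ s, ι d ^ m = ι c ^ m) →
            ι x * (s.map ι).prod = ι x ^ (s.length + 1) := by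
          intro s
          induction s with
          | nil => simp
          | cons d s ihs =>
            intro hs
            have hd := hs d List.mem_cons_self
            have hxd : ι x * ι d = ι x * ι x := by
              rcases h.trichotomy x d with h2 | h2 | h2
              · exact absurd (h2.trans hd) hxc
              · exact h2.1
              · rw [hd] at h2
                exact absurd (h1.2.symm.trans h2.2) hxc
            rw [List.map_cons, List.prod_cons, ← mul_assoc, hxd, mul_assoc,
              ihs fun e he => hs e (List.mem_cons_of_mem _ he), List.length_cons, ← pow_succ']
        rw [key t hcl]
        simp
      · intro d hd
        rw [List.eq_of_mem_replicate hd]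
    · obtain ⟨y, s, rfl⟩ : ∃ y s, t = y :: s :=
        List.exists_cons_of_ne_nil (List.ne_nil_of_mem hc)
      have hy := hcl y List.mem_cons_self
      by_cases hxc : ι x ^ m = ι c ^ m
      · refine ⟨x :: y :: s, by simp [hlen], List.cons_subset_cons x hsub, by simp, c,
          by simp [hc], ?_⟩
        rintro d (_ | ⟨_, hd⟩)
        exacts [hxc, hcl d hd]
      have hxy : ι x * ι y = ι y * ι y := by
        rcases h.trichotomy x y with h2 | h2 | h2
        · exact absurd (h2.trans hy) hxc
        · rw [hy] at h2
          exact absurd (h2.2.symm.trans h1.2) hxc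
        · exact h2.1
      refine ⟨y :: y :: s, by simp [hlen], ?_, ?_, c, List.mem_cons_of_mem _ hc, ?_⟩
      · rintro d (_ | ⟨_, hd⟩)
        exacts [List.mem_cons_of_mem _ (hsub (by simp)), List.mem_cons_of_mem _ (hsub hd)]
      · simp [← mul_assoc, hxy]
      · rintro d (_ | ⟨_, hd⟩)
        exacts [hy, hcl d hd]

/-- A product of `m + 1` elements that is not one of its factors yields at least three
elements sharing one idempotent power. -/
theorem exists_class (h : IsQuasitrivialEmbedding m ι) {l : List X} (hl : l.length = m + 1)
    {z : X} (hz : ι z = (l.map ι).prod) (hzl : z ∉ l) :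
    ∃ c ∈ l, ∃ d ∈ l, c ≠ d ∧ ι d ^ m = ι c ^ m ∧ ι z ^ m = ι c ^ m := by
  obtain ⟨l', hlen, hsub, hprod, c, hc, hcl⟩ :=
    h.exists_list (l := l) (by rintro rfl; simp at hl)
  have hzc : ι z ^ m = ι c ^ m := by
    rw [hz, ← hprod, h.prod_pow (List.ne_nil_of_mem hc) hcl]
  by_cases hall : ∀ d ∈ l', d = c
  · have : l' = List.replicate (m + 1) c := List.eq_replicate_iff.2 ⟨by omega, hall⟩
    rw [← hprod, this, List.map_replicate, List.prod_replicate, pow_succ, h.pow_mul_self] at hz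
    exact absurd (hsub hc) (h.injective hz ▸ hzl)
  · push Not at hall
    obtain ⟨d, hd, hdc⟩ := hall
    exact ⟨c, hsub hc, d, hsub hd, hdc.symm, hcl d hd, hzc⟩

theorem exists_binary (h : IsQuasitrivialEmbedding m ι) (e : X) :
    ∃ G : X → X → X, ∀ a b, ι (G a b) = ι a * ι e ^ (m - 1) * ι b := by
  have (a b : X) : ∃ c, ι c = ι a * ι e ^ (m - 1) * ι b := by
    obtain ⟨c, hc⟩ := h.closed (a :: (List.replicate (m - 1) e ++ [b]))
      (by have := h.two_le; simp; omega)
    exact ⟨c, by simpa [mul_assoc] using hc⟩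
  choose G hG using this
  exact ⟨G, hG⟩

theorem iterOp_eq (h : IsQuasitrivialEmbedding m ι) {e : X} {G : X → X → X}
    (hG : ∀ a b, ι (G a b) = ι a * ι e ^ (m - 1) * ι b) (k : ℕ) (x : ℕ → X)
    (hx : ∀ i ≤ k, ι (x i) ^ m = ι e ^ m) :
    ι (iterOp G k x) = (List.ofFn fun i : Fin (k + 1) => ι (x i)).prod *
      ι e ^ ((m - 1) * k) := by
  induction k generalizing x with
  | zero => simp [iterOp]
  | succ k ih =>
    rw [iterOp, hG, ih _ fun i hi => hx (i + 1) (by omega),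
      List.ofFn_succ (f := fun i : Fin (k + 1 + 1) => ι (x i)), List.prod_cons]
    have hc : Commute (ι e ^ (m - 1))
        (List.ofFn fun i : Fin (k + 1) => ι (x (i + 1))).prod := by
      refine Commute.list_prod_right _ _ fun y hy => ?_
      obtain ⟨i, rfl⟩ := List.mem_ofFn.1 hy
      exact Commute.pow_left (h.mul_comm_of_pow_eq (hx _ (by omega)).symm) _
    simp only [Fin.val_zero, Fin.val_succ]
    rw [mul_assoc, ← mul_assoc (ι e ^ (m - 1)), hc.eq, mul_assoc, mul_assoc, ← pow_add]
    congr 3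
    ring

end IsQuasitrivialEmbedding

theorem gPow_eq_iterOp (G : X → X → X) (a : X) (k : ℕ) :
    gPow G a k = iterOp G k fun _ => a := by
  induction k with
  | zero => rfl
  | succ k ih => rw [gPow, iterOp, ih]

namespace IsQuasitrivialEmbedding

variable {M : Type*} [Monoid M] {m : ℕ} {ι : X → M} {a b c d : X}

theorem isAbelianGroup (h : IsQuasitrivialEmbedding m ι) {e : X} {G : X → X → X}
    (hG : ∀ a b, ι (G a b) = ι a * ι e ^ (m - 1) * ι b) :
    IsAbelianGroupOfExpDvdOn {a | ι a ^ m = ι e ^ m} G m := by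
  have hm := h.two_le
  have hcomm {a b : X} (ha : ι a ^ m = ι e ^ m) (hb : ι b ^ m = ι e ^ m) :
      Commute (ι a) (ι b) := h.mul_comm_of_pow_eq (ha.trans hb.symm)
  have hid : IsIdempotentElem (ι e ^ m) := h.pow_mul_pow_self e
  refine ⟨?_, ?_, ?_, e, rfl, ?_, ?_, ?_⟩
  · intro a ha b hb
    rw [Set.mem_ofPred_eq] at ha hb ⊢
    have h1 : Commute (ι a) (ι e ^ (m - 1)) := (hcomm ha rfl).pow_right _
    have h2 : Commute (ι a * ι e ^ (m - 1)) (ι b) :=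
      (hcomm ha hb).mul_left ((hcomm rfl hb).pow_left _)
    rw [hG, h2.mul_pow, h1.mul_pow, ha, hb, ← pow_mul, mul_comm (m - 1), pow_mul,
      hid.pow_eq (by omega), hid, hid]
  · intro a ha b hb
    apply h.injective
    rw [hG, hG, ((hcomm ha rfl).pow_right _).eq, mul_assoc, (hcomm ha hb).eq, ← mul_assoc,
      ((hcomm hb rfl).pow_right _).eq]
  · intro a _ b _ c _
    apply h.injective
    simp only [hG, mul_assoc]
  · intro a ha
    apply h.injective
    rw [hG, h.self_mul_pow_sub, ← ha, h.pow_mul_self]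
  · intro a ha
    rw [Set.mem_ofPred_eq] at ha
    obtain ⟨b, hb⟩ := h.closed (e :: e :: List.replicate (m - 1) a) (by simp; omega)
    have hb' : ι b = ι e * (ι e * ι a ^ (m - 1)) := by simpa using hb
    have hbe : ι b ^ m = ι e ^ m := by
      rw [hb]
      refine h.prod_pow (by simp) fun d hd => ?_
      rw [List.mem_cons, List.mem_cons] at hd
      rcases hd with rfl | rfl | hd
      exacts [rfl, rfl, List.eq_of_mem_replicate hd ▸ ha]
    refine ⟨b, hbe, h.injective ?_⟩
    calc ι (G a b) = ι a * ((ι e ^ (m - 1) * ι e) * ι e) * ι a ^ (m - 1) := by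
          rw [hG, hb']; simp only [mul_assoc]
      _ = ι e := by
          rw [h.pow_sub_mul_self, h.pow_mul_self, (hcomm ha rfl).eq, mul_assoc,
            h.self_mul_pow_sub, ha, h.self_mul_pow]
  · intro a ha
    apply h.injective
    rw [gPow_eq_iterOp, h.iterOp_eq hG _ _ fun _ _ => ha]
    obtain ⟨k, rfl⟩ : ∃ k, m = k + 2 := ⟨m - 2, by omega⟩
    have : (k + 2 - 1) * (k + 2 - 1) = (k + 2) * k + 1 := by
      simp only [Nat.add_succ_sub_one]; ring
    rw [List.ofFn_const, List.prod_replicate, this]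
    simp only [Nat.add_succ_sub_one]
    rw [show k + 1 + 1 = k + 2 from rfl, ha, pow_succ _ ((k + 2) * k), pow_mul, ← mul_assoc,
      ← pow_succ', hid.pow_eq (by omega), h.pow_mul_self]

theorem pow_mul_pred (h : IsQuasitrivialEmbedding m ι) (e : X) :
    ι e ^ ((m - 1) * m) = ι e ^ m := by
  have hid : IsIdempotentElem (ι e ^ m) := h.pow_mul_pow_self e
  rw [mul_comm, pow_mul, hid.pow_eq (by have := h.two_le; omega)]

theorem mul_prod_of_pow_ne (h : IsQuasitrivialEmbedding m ι) (hab : ι a ^ m = ι b ^ m)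
    (hne : a ≠ b) (hc : ι c ^ m ≠ ι a ^ m) {l : List X}
    (hl : ∀ d ∈ l, d = c ∨ ι d ^ m = ι a ^ m) :
    ι c * (l.map ι).prod = ι c ^ (l.length + 1) := by
  induction l with
  | nil => simp
  | cons d l ih =>
    have hcd : ι c * ι d = ι c * ι c := by
      rcases hl d List.mem_cons_self with rfl | hd
      · rfl
      · obtain ⟨e, hde, hed⟩ : ∃ e, ι d ^ m = ι e ^ m ∧ d ≠ e := by
          by_cases hda : d = a
          · exact ⟨b, hda ▸ hab, hda ▸ hne⟩
          · exact ⟨a, hd, hda⟩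
        exact (h.mul_eq_of_pow_ne hde hed (hd ▸ hc)).2
    rw [List.map_cons, List.prod_cons, ← mul_assoc, hcd, mul_assoc,
      ih fun e he => hl e (List.mem_cons_of_mem _ he), List.length_cons, ← pow_succ']

theorem prod_of_pow_ne (h : IsQuasitrivialEmbedding m ι) (hab : ι a ^ m = ι b ^ m)
    (hne : a ≠ b) (hc : ι c ^ m ≠ ι a ^ m) {l : List X}
    (hl : ∀ d ∈ l, d = c ∨ ι d ^ m = ι a ^ m) (hcl : c ∈ l) :
    (l.map ι).prod = ι c ^ l.length := by
  induction l with
  | nil => simp at hcl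
  | cons d l ih =>
    have hl' : ∀ e ∈ l, e = c ∨ ι e ^ m = ι a ^ m :=
      fun e he => hl e (List.mem_cons_of_mem _ he)
    rcases eq_or_ne d c with rfl | hdc
    · exact h.mul_prod_of_pow_ne hab hne hc hl'
    · have hcl' : c ∈ l := (List.mem_cons.1 hcl).resolve_left hdc.symm
      have hd := (hl d List.mem_cons_self).resolve_left hdc
      obtain ⟨e, hde, hed⟩ : ∃ e, ι d ^ m = ι e ^ m ∧ d ≠ e := by
        by_cases hda : d = a
        · exact ⟨b, hda ▸ hab, hda ▸ hne⟩
        · exact ⟨a, hd, hda⟩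
      have hdc' := (h.mul_eq_of_pow_ne hde hed (hd ▸ hc)).1
      obtain ⟨k, hk⟩ : ∃ k, l.length = k + 1 :=
        Nat.exists_eq_succ_of_ne_zero (List.length_pos_of_mem hcl').ne'
      rw [List.map_cons, List.prod_cons, ih hl' hcl', List.length_cons, hk, pow_succ',
        ← mul_assoc, hdc', mul_assoc, ← pow_succ', ← pow_succ']

end IsQuasitrivialEmbedding

theorem MemD.exists_eq_update {m : ℕ} (hm : 1 ≤ m) {x : Fin (m + 1) → X}
    (hx : MemD (m + 1) m x) : ∃ a b p, x = Function.update (fun _ => a) p b := by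
  obtain ⟨S, hS, hSx⟩ := hx
  obtain ⟨i, hi⟩ : S.Nonempty := Finset.card_pos.1 (by omega)
  have hc : Sᶜ.card ≤ 1 := by rw [Finset.card_compl, Fintype.card_fin]; omega
  obtain ⟨p, hp⟩ : ∃ p, Sᶜ ⊆ {p} := Finset.card_le_one_iff_subset_singleton.1 hc
  refine ⟨x i, x p, p, funext fun j => ?_⟩
  by_cases hj : j = p
  · rw [hj, Function.update_self]
  · rw [Function.update_of_ne hj]
    refine hSx j ?_ i hi
    by_contra hjS
    exact hj (Finset.mem_singleton.1 (hp (Finset.mem_compl.2 hjS)))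

theorem IsAbelianGroupOfExpDvdOn.exists_commGroup {Y : Set X} {G : X → X → X} {m : ℕ}
    (hm : 1 ≤ m) (h : IsAbelianGroupOfExpDvdOn Y G m) :
    ∃ _ : CommGroup Y, (∀ a b : Y, ((a * b : Y) : X) = G a b) ∧ ∀ a : Y, a ^ m = 1 := by
  obtain ⟨hcl, hcomm, hassoc, e, he, hone, hinv, hpow⟩ := h
  choose! inv hinvY hinv using hinv
  let gr : CommGroup Y :=
    { mul := fun a b => ⟨G a b, hcl a a.2 b b.2⟩
      mul_assoc := fun a b c => Subtype.ext (hassoc a a.2 b b.2 c c.2)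
      one := ⟨e, he⟩
      one_mul := fun a => Subtype.ext (hone a a.2)
      mul_one := fun a => Subtype.ext ((hcomm a a.2 e he).trans (hone a a.2))
      inv := fun a => ⟨inv a, hinvY a a.2⟩
      inv_mul_cancel := fun a => Subtype.ext
        ((hcomm _ (hinvY a a.2) a a.2).trans (hinv a a.2))
      mul_comm := fun a b => Subtype.ext (hcomm a a.2 b b.2) }
  have hmul (a b : Y) : ((a * b : Y) : X) = G a b := rfl
  refine ⟨gr, hmul, fun a => ?_⟩
  have key (k : ℕ) : ((a ^ (k + 1) : Y) : X) = gPow G a k := by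
    induction k with
    | zero => rw [zero_add, pow_one, gPow]
    | succ k ih => rw [pow_succ', hmul, ih, gPow]
  refine Subtype.ext ?_
  have := key (m - 1)
  rw [Nat.sub_add_cancel hm, hpow a a.2] at this
  exact this

theorem iterOp_eq_prod {Y : Set X} [CommGroup Y] {G : X → X → X}
    (hG : ∀ a b : Y, ((a * b : Y) : X) = G a b) (k : ℕ) (x : ℕ → Y) :
    iterOp G k (fun i => (x i : X)) = ((∏ i : Fin (k + 1), x i : Y) : X) := by
  induction k generalizing x with
  | zero => simp [iterOp]
  | succ k ih =>
    rw [iterOp, ih fun i => x (i + 1), Fin.prod_univ_succ (fun i : Fin (k + 1 + 1) => x i), hG]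
    simp

namespace Cond13

variable {m : ℕ} {F : (Fin (m + 1) → X) → X} {Y : Set X}

theorem exists_commGroup (hm : 2 ≤ m) (h : Cond13 (m + 1) F Y) :
    ∃ _ : CommGroup Y, (∀ y : Fin (m + 1) → Y, F (fun i => y i) = ((∏ i, y i : Y) : X)) ∧
      ∀ a : Y, a ^ m = 1 := by
  obtain ⟨-, ⟨G, hG, hF⟩, -⟩ := h
  obtain ⟨gr, hmul, hpow⟩ := hG.exists_commGroup (by omega)
  refine ⟨gr, fun y => ?_, hpow⟩
  have hext (i : Fin (m + 1)) : Fin.ofNat (m + 1) (i : ℕ) = i := Fin.cast_val_eq_self i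
  have h1 := hF (fun i => y (Fin.ofNat (m + 1) i)) fun _ _ => Subtype.coe_prop _
  have h2 := iterOp_eq_prod hmul m fun i => y (Fin.ofNat (m + 1) i)
  simp only [hext] at h1 h2
  exact h1.trans h2

theorem map_update_of_mem (hm : 2 ≤ m) (h : Cond13 (m + 1) F Y) {a b : X} (ha : a ∈ Y)
    (hb : b ∈ Y) (p : Fin (m + 1)) : F (Function.update (fun _ => a) p b) = b := by
  obtain ⟨gr, hF, hpow⟩ := h.exists_commGroup hm
  have h1 := hF (Function.update (fun _ => ⟨a, ha⟩) p ⟨b, hb⟩)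
  rw [Finset.prod_update_of_mem (Finset.mem_univ p), Finset.prod_const,
    Finset.card_sdiff_of_subset (Finset.subset_univ _), Finset.card_univ, Fintype.card_fin,
    Finset.card_singleton, Nat.add_sub_cancel, hpow, mul_one] at h1
  have h2 : (fun i => ((Function.update (fun _ => ⟨a, ha⟩) p ⟨b, hb⟩ : Fin (m + 1) → Y) i : X)) =
      Function.update (fun _ => a) p b := by
    funext i
    by_cases hi : i = p
    · subst hi; simp
    · simp [hi]
  rwa [h2] at h1

theorem map_update_of_notMem (h : Cond13 (m + 1) F Y) {a b : X} (ha : a ∈ Y)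
    (hb : b ∉ Y) (p : Fin (m + 1)) : F (Function.update (fun _ => a) p b) = b := by
  refine h.2.2.2 b hb _ (fun i => ?_) ⟨p, Function.update_self ..⟩
  by_cases hi : i = p
  · rw [hi, Function.update_self]; exact Set.mem_insert _ _
  · rw [Function.update_of_ne hi]; exact Set.mem_insert_of_mem _ ha

theorem map_update_const_of_notMem (hm : 2 ≤ m) (h : Cond13 (m + 1) F Y) {a b : X}
    (ha : a ∉ Y) (hb : b ∈ Y) (p : Fin (m + 1)) :
    F (Function.update (fun _ => a) p b) = a := by
  have : Nontrivial (Fin (m + 1)) := Fin.nontrivial_iff_two_le.2 (by omega)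
  obtain ⟨q, hq⟩ := exists_ne p
  refine h.2.2.2 a ha _ (fun i => ?_) ⟨q, Function.update_of_ne hq ..⟩
  by_cases hi : i = p
  · rw [hi, Function.update_self]; exact Set.mem_insert_of_mem _ hb
  · rw [Function.update_of_ne hi]; exact Set.mem_insert _ _

theorem eq_naryNeutralSet (hm : 2 ≤ m) (h : Cond13 (m + 1) F Y) :
    Y = naryNeutralSet (m + 1) F := by
  ext e
  constructor
  · intro he a p
    by_cases ha : a ∈ Y
    · exact h.map_update_of_mem hm he ha p
    · exact h.map_update_of_notMem he ha p
  · intro he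
    by_contra heY
    obtain ⟨a, ha⟩ : Y.Nonempty := by
      rw [Set.nonempty_iff_ne_empty]
      rintro rfl
      simpa using h.1
    have h1 := h.map_update_const_of_notMem hm heY ha 0
    rw [he a 0] at h1
    exact heY (h1 ▸ ha)

theorem naryQuasitrivialOnD (hm : 2 ≤ m) (h : Cond13 (m + 1) F Y) :
    NAryQuasitrivialOnD (m + 1) m F := by
  intro x hx
  obtain ⟨a, b, p, rfl⟩ := hx.exists_eq_update (by omega)
  have hb' : b ∈ Set.range (Function.update (fun _ => a) p b) := ⟨p, Function.update_self ..⟩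
  by_cases ha : a ∈ Y <;> by_cases hb : b ∈ Y
  · rwa [h.map_update_of_mem hm ha hb]
  · rwa [h.map_update_of_notMem ha hb]
  · have : Nontrivial (Fin (m + 1)) := Fin.nontrivial_iff_two_le.2 (by omega)
    obtain ⟨q, hq⟩ := exists_ne p
    rw [h.map_update_const_of_notMem hm ha hb]
    exact ⟨q, Function.update_of_ne hq ..⟩
  · refine h.2.2.1.1 _ fun i => ?_
    by_cases hi : i = p
    · rwa [hi, Function.update_self]
    · rwa [Function.update_of_ne hi]

theorem not_naryQuasitrivial (hm : 2 ≤ m) (h : Cond13 (m + 1) F Y) :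
    ¬NAryQuasitrivial (m + 1) F := by
  intro hq
  obtain ⟨gr, hF, -⟩ := h.exists_commGroup hm
  obtain ⟨u, v, hu, hv, huv⟩ : ∃ u v : Y, u ≠ 1 ∧ v ≠ 1 ∧ u ≠ v := by
    obtain ⟨t, ht, htc⟩ := Set.exists_subset_encard_eq h.1
    obtain ⟨a, b, c, hab, hac, hbc, rfl⟩ := Set.encard_eq_three.1 htc
    have ha : a ∈ Y := ht (by simp)
    have hb : b ∈ Y := ht (by simp)
    have hc : c ∈ Y := ht (by simp)
    by_cases h1 : a = (1 : Y)
    · exact ⟨⟨b, hb⟩, ⟨c, hc⟩, by grind, by grind, by grind⟩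
    · by_cases h2 : b = (1 : Y)
      · exact ⟨⟨a, ha⟩, ⟨c, hc⟩, by grind, by grind, by grind⟩
      · exact ⟨⟨a, ha⟩, ⟨b, hb⟩, by grind, by grind, by grind⟩
  obtain ⟨a, b, ha, hb, hab⟩ : ∃ a b : Y, a ≠ 1 ∧ b ≠ 1 ∧ a * b ≠ 1 := by
    by_cases h1 : u * v = 1
    · exact ⟨u, u, hu, hu, fun h2 => huv (mul_left_cancel (h2.trans h1.symm))⟩
    · exact ⟨u, v, hu, hv, h1⟩
  obtain ⟨k, rfl⟩ : ∃ k, m = k + 1 := ⟨m - 1, by omega⟩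
  let y : Fin (k + 1 + 1) → Y := Fin.cons a (Fin.cons b fun _ => 1)
  have hy : ∏ i, y i = a * b := by simp [y, Fin.prod_univ_succ]
  obtain ⟨i, hi⟩ := hq fun i => y i
  rw [hF, hy] at hi
  have hi := Subtype.ext hi
  refine Fin.cases (fun h0 => ?_) (fun j => Fin.cases (fun h0 => ?_) (fun j h0 => ?_) j) i hi
  · exact hb (by simpa [y] using h0)
  · exact ha (by simpa [y] using h0)
  · exact hab (by simpa [y] using h0.symm)

end Cond13

theorem isQuasitrivialEmbedding_of_naryQuasitrivialOnD {M : Type*} [Monoid M] {m : ℕ}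
    (hm : 2 ≤ m) {F : (Fin (m + 1) → X) → X} {ι : X → M} (hι : Function.Injective ι)
    (hF : ∀ x : Fin (m + 1) → X, (List.ofFn fun i => ι (x i)).prod = ι (F x))
    (hQ : NAryQuasitrivialOnD (m + 1) m F) : IsQuasitrivialEmbedding m ι where
  two_le := hm
  injective := hι
  closed l hl := by
    refine ⟨F fun i => l[(i : ℕ)], ?_⟩
    rw [← hF]
    congr 1
    refine List.ext_getElem (by simp [hl]) fun i h1 h2 => ?_
    rw [List.getElem_ofFn, List.getElem_map]
  quasi a b i j hij := by
    let l := List.replicate i a ++ b :: List.replicate j a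
    have hl : l.length = m + 1 := by simp [l]; omega
    have hprod : ι (F fun k => l[(k : ℕ)]) = ι a ^ i * ι b * ι a ^ j := by
      have : ι a ^ i * ι b * ι a ^ j = (l.map ι).prod := by simp [l, mul_assoc]
      rw [← hF, this]
      congr 1
      refine List.ext_getElem (by simp [hl]) fun i h1 h2 => ?_
      rw [List.getElem_ofFn, List.getElem_map]
    have hmem : MemD (m + 1) m fun k => l[(k : ℕ)] := by
      refine ⟨Finset.univ.erase ⟨i, by omega⟩, by simp, fun p hp q hq => ?_⟩
      have key (r : Fin (m + 1)) (hr : r ∈ Finset.univ.erase (⟨i, by omega⟩ : Fin (m + 1))) :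
          l[(r : ℕ)] = a := by
        have hr' : (r : ℕ) ≠ i := fun h => (Finset.mem_erase.1 hr).1 (Fin.ext h)
        rcases Nat.lt_or_gt_of_ne hr' with h | h
        · simp [l, h]
        · obtain ⟨d, hd⟩ : ∃ d, (r : ℕ) = i + (d + 1) := ⟨r - i - 1, by omega⟩
          simp [l, hd]
      exact (key p hp).trans (key q hq).symm
    obtain ⟨k, hk⟩ := hQ _ hmem
    rw [← hprod, ← hk]
    have : l[(k : ℕ)] ∈ l := List.getElem_mem _
    have h2 : l[(k : ℕ)] = a ∨ l[(k : ℕ)] = b := by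
      rcases List.mem_append.1 this with h | h
      · exact Or.inl (List.eq_of_mem_replicate h)
      · rcases List.mem_cons.1 h with h | h
        · exact Or.inr h
        · exact Or.inl (List.eq_of_mem_replicate h)
    exact h2.imp (congrArg ι) (congrArg ι)

theorem exists_cond13 [Nonempty X] {m : ℕ} (hm : 2 ≤ m) {F : (Fin (m + 1) → X) → X}
    (hA : NAryAssociative (m + 1) F) (hQ : NAryQuasitrivialOnD (m + 1) m F)
    (hF : ¬NAryQuasitrivial (m + 1) F) : ∃ Y, Cond13 (m + 1) F Y := by
  obtain ⟨M, _, ι, hι, hprod⟩ := exists_monoid_of_naryAssociative hm hA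
  have h := isQuasitrivialEmbedding_of_naryQuasitrivialOnD hm hι hprod hQ
  have hprod' (x : Fin (m + 1) → X) : ι (F x) = ((List.ofFn x).map ι).prod := by
    rw [← hprod, List.map_ofFn, Function.comp_def]
  have hclass (x : Fin (m + 1) → X) (hx : F x ∉ Set.range x) :=
    h.exists_class (l := List.ofFn x) (by simp) (hprod' x) (by rwa [List.mem_ofFn'])
  obtain ⟨x, hx⟩ := not_forall.1 hF
  obtain ⟨c, hc, d, hd, hcd, hdc, hzc⟩ := hclass x hx
  have hunique {a b : X} (hab : ι b ^ m = ι a ^ m) (hne : a ≠ b) : ι a ^ m = ι c ^ m :=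
    h.pow_eq_of_identity (h.pow_mul_of_ne hab.symm hne c) (h.mul_pow_of_ne hdc.symm hcd a)
  refine ⟨{a | ι a ^ m = ι c ^ m}, ?_, ?_, ⟨fun y hy => ?_, ?_⟩, ?_⟩
  · have h3 : ({c, d, F x} : Set X).encard = 3 := by
      refine Set.encard_eq_three.2 ⟨c, d, F x, hcd, ?_, ?_, rfl⟩
      · rintro rfl; exact hx ((List.mem_ofFn' _ _).1 hc)
      · rintro rfl; exact hx ((List.mem_ofFn' _ _).1 hd)
    rw [← h3]
    refine Set.encard_le_encard ?_
    rintro a (rfl | rfl | rfl)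
    exacts [rfl, hdc, hzc]
  · obtain ⟨G, hG⟩ := h.exists_binary c
    refine ⟨G, h.isAbelianGroup hG, fun x hx => hι ?_⟩
    rw [Nat.add_sub_cancel, h.iterOp_eq hG _ _ fun i hi => hx i (by omega), h.pow_mul_pred,
      hprod fun i => x i, h.mul_pow_of_ne hdc.symm hcd]
  · by_contra hyF
    obtain ⟨a, ha, b, -, hab, hba, -⟩ := hclass y hyF
    obtain ⟨i, rfl⟩ := List.mem_ofFn.1 ha
    exact hy i (hunique hba hab)
  · rintro a ⟨haY, ha⟩ b ⟨hbY, hb⟩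
    by_contra hab
    have h1 : ι a ^ m * ι b = ι b := by
      have := hprod (Function.update (fun _ => a) (Fin.last m) b)
      rw [ha b hbY, List.ofFn_succ'] at this
      simpa [Function.update_of_ne, (Fin.castSucc_lt_last _).ne] using this
    have h2 : ι a * ι b ^ m = ι a := by
      have := hprod (Function.update (fun _ => b) 0 a)
      rw [hb a haY, List.ofFn_succ] at this
      simpa [Function.update_of_ne, Fin.succ_ne_zero] using this
    exact haY (hunique (h.pow_eq_of_identity h1 h2).symm hab)
  · rintro a haY y hy ⟨i, hi⟩
    apply hι
    rw [hprod', h.prod_of_pow_ne hdc.symm hcd haY, List.length_ofFn, pow_succ, h.pow_mul_self]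
    · intro b hb
      obtain ⟨j, rfl⟩ := List.mem_ofFn.1 hb
      exact hy j
    · exact List.mem_ofFn.2 ⟨i, hi⟩

/-- Characterization of the class `𝓕ⁿ_{n-1} \ 𝓕ⁿ₁`: assuming this class is nonempty, an
associative `F` is quasitrivial on `D^n_{n-1}` but not quasitrivial iff there is a unique
subset `Y ⊆ X` with `|Y| ≥ 3` satisfying (a), (b), (c); moreover `Y = E_F`. -/
theorem stmt_13 {X : Type*} [Nonempty X] (n : ℕ) (hn : 3 ≤ n)
    (hne : ∃ F₀ : (Fin n → X) → X, NAryAssociative n F₀ ∧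
      NAryQuasitrivialOnD n (n - 1) F₀ ∧ ¬NAryQuasitrivial n F₀)
    (F : (Fin n → X) → X) (hF : NAryAssociative n F) :
    ((NAryQuasitrivialOnD n (n - 1) F ∧ ¬NAryQuasitrivial n F) ↔
      ∃! Y : Set X, Cond13 n F Y) ∧
    ((NAryQuasitrivialOnD n (n - 1) F ∧ ¬NAryQuasitrivial n F) →
      ∀ Y : Set X, Cond13 n F Y → Y = naryNeutralSet n F) := by
  obtain ⟨m, rfl⟩ : ∃ m, n = m + 1 := ⟨n - 1, by omega⟩
  have hm : 2 ≤ m := by omega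
  rw [Nat.add_sub_cancel]
  refine ⟨⟨fun h => ?_, fun ⟨Y, hY, _⟩ => ⟨hY.naryQuasitrivialOnD hm, hY.not_naryQuasitrivial hm⟩⟩,
    fun _ Y hY => hY.eq_naryNeutralSet hm⟩
  obtain ⟨Y, hY⟩ := exists_cond13 hm hF h.1 h.2
  exact ⟨Y, hY, fun Z hZ => (hZ.eq_naryNeutralSet hm).trans (hY.eq_naryNeutralSet hm).symm⟩
end

section
/- Let X be a nonempty set, n ≥ 3, and suppose there exists an associative operation X^n → X that is quasitrivial on D^n_{n-1} but not quasitrivial. Then an operation F : X^n → X is associative, quasitrivial on D^n_{n-1}, and not quasitrivial if and only if F is reducible to an associative binary operation G : X^2 → X and there exists a unique subset Y ⊆ X with |Y| ≥ 3 such that: (a) (Y, G|_{Y^2}) is an Abelian group whose exponent divides n-1; (b) G|_{(X \ Y)^2} is quasitrivial; (c) every x ∈ X \ Y is an annihilator for G|_{({x} ∪ Y)^2}. Moreover, in that case Y = E_F. -/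
variable {X : Type*}

/-- Conditions (a), (b), (c) of Corollary 1.10, together with `|Y| ≥ 3`, for a binary
operation `G` and a subset `Y`: (a) `(Y, G|_{Y²})` is an Abelian group whose exponent
divides `n - 1`; (b) `G|_{(X \ Y)²}` is quasitrivial; (c) any `x ∈ X \ Y` is an annihilator
for `G|_{({x} ∪ Y)²}`. -/
def Cond15 {X : Type*} (n : ℕ) (G : X → X → X) (Y : Set X) : Prop :=
  3 ≤ Y.encard ∧
  IsAbelianGroupOfExpDvdOn Y G (n - 1) ∧
  (∀ a ∈ Yᶜ, ∀ b ∈ Yᶜ, G a b = a ∨ G a b = b) ∧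
  (∀ x ∈ Yᶜ, ∀ a ∈ insert x Y, ∀ b ∈ insert x Y, (a = x ∨ b = x) → G a b = x)

section Covering

/-- The sequence obtained from `x` by replacing the block of `m + 1` consecutive entries starting
at position `i` with its `F`-value. -/
def substAt (m : ℕ) (F : (Fin (m + 1) → X) → X) (x : ℕ → X) (i : ℕ) : ℕ → X := fun j =>
  if j < i then x j else if j = i then F (fun k => x (i + (k : ℕ))) else x (j + m)

/-- The `F`-product of the first `k * m + 1` entries of `x`, bracketed from the left. -/
def leftProd (m : ℕ) (F : (Fin (m + 1) → X) → X) : ℕ → (ℕ → X) → X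
  | 0, x => x 0
  | k + 1, x => leftProd m F k (substAt m F x 0)

variable {m : ℕ} {F : (Fin (m + 1) → X) → X}

theorem NAryAssociative.apply_substAt (hF : NAryAssociative (m + 1) F) (x : ℕ → X) {i : ℕ}
    (hi : i ≤ m) :
    F (fun j => substAt m F x i j) = F (fun j => substAt m F x 0 j) := by
  induction i with
  | zero => rfl
  | succ i ih => exact (hF x i hi).symm.trans (ih (by omega))

theorem NAryAssociative.leftProd_substAt (hF : NAryAssociative (m + 1) F) (k : ℕ) (x : ℕ → X)
    (i : ℕ) (hi : i ≤ k * m) :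
    leftProd m F k (substAt m F x i) = leftProd m F (k + 1) x := by
  induction k generalizing x i with
  | zero =>
    obtain rfl : i = 0 := by omega
    rfl
  | succ k ih =>
    have hi' : i ≤ k * m + m := by rwa [Nat.succ_mul] at hi
    rcases le_or_gt i m with him | him
    · change leftProd m F k (substAt m F (substAt m F x i) 0) =
        leftProd m F k (substAt m F (substAt m F x 0) 0)
      congr 1
      funext j
      have h := hF.apply_substAt x him
      rcases Nat.eq_zero_or_pos j with rfl | hj
      · simpa [substAt] using h
      · have h1 : ¬ j + m < i := by omega
        have h2 : j + m ≠ i := by omega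
        simp [substAt, h1, h2, hj.ne']
    · change _ = leftProd m F (k + 1) (substAt m F x 0)
      rw [← ih (substAt m F x 0) (i - m) (by omega)]
      change leftProd m F k (substAt m F (substAt m F x i) 0) = _
      congr 1
      funext j
      rcases Nat.eq_zero_or_pos j with rfl | hj
      · have h0 : 0 < i - m := by omega
        simp only [substAt, lt_irrefl, if_false, if_true, h0]
        congr 1
        funext l
        have := l.2
        simp
        omega
      · rcases lt_trichotomy j (i - m) with h | h | h
        · have h1 : j + m < i := by omega
          simp [substAt, hj.ne', h, h1]
        · have h1 : j + m = i := by omega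
          have h2 : i - m ≠ 0 := by omega
          simp only [substAt, h, lt_irrefl, if_false, if_true, h2, Nat.not_lt_zero]
          simp only [show i - m + m = i by omega, lt_irrefl, if_false, if_true]
          congr 1
          funext l
          have h3 : i - m + (l : ℕ) ≠ 0 := by omega
          simp only [h3, if_false]
          congr 1
          omega
        · have h1 : ¬ j + m < i := by omega
          have h2 : j + m ≠ i := by omega
          have h3 : ¬ j < i - m := by omega
          have h4 : j ≠ i - m := by omega
          simp [substAt, hj.ne', h1, h2, h3, h4]

/-- The `F`-product of a word whose length is congruent to `1` modulo `m`. -/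
def wordProd (m : ℕ) (F : (Fin (m + 1) → X) → X) (d : X) (w : List X) : X :=
  leftProd m F ((w.length - 1) / m) fun j => w.getD j d

theorem NAryAssociative.wordProd_append (hF : NAryAssociative (m + 1) F) (hm : 0 < m) (d : X)
    (p q : List X) (x : Fin (m + 1) → X) (hpq : m ∣ p.length + q.length) :
    wordProd m F d (p ++ List.ofFn x ++ q) = wordProd m F d (p ++ [F x] ++ q) := by
  obtain ⟨k, hk⟩ := hpq
  have h1 : ((p ++ List.ofFn x ++ q).length - 1) / m = k + 1 := by
    have : (p ++ List.ofFn x ++ q).length - 1 = m * (k + 1) := by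
      simp only [List.length_append, List.length_ofFn, mul_add]; omega
    rw [this, Nat.mul_div_cancel_left _ hm]
  have h2 : ((p ++ [F x] ++ q).length - 1) / m = k := by
    have : (p ++ [F x] ++ q).length - 1 = m * k := by
      simp only [List.length_append, List.length_singleton]; omega
    rw [this, Nat.mul_div_cancel_left _ hm]
  unfold wordProd
  rw [h1, h2, ← hF.leftProd_substAt k _ p.length (by rw [mul_comm]; omega)]
  congr 1
  funext j
  rcases lt_trichotomy j p.length with h | h | h
  · simp [substAt, h, List.getElem?_append]
  · subst h
    simp only [substAt, lt_irrefl, if_false, if_true]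
    have : (fun l : Fin (m + 1) => (p ++ List.ofFn x ++ q).getD (p.length + (l : ℕ)) d) = x := by
      funext l
      have h3 : (l : ℕ) < (List.ofFn x).length := by simp [l.2]
      rw [List.append_assoc, List.getD_append_right _ _ _ _ (by omega), Nat.add_sub_cancel_left,
        List.getD_append _ _ _ _ h3]
      simp [List.getD_eq_getElem?_getD, -List.ofFn_succ, Nat.le_of_lt_succ l.2]
    rw [this]
    simp
  · obtain ⟨t, rfl⟩ := Nat.exists_eq_add_of_lt h
    clear h1 h2 h
    have e1 : ¬ p.length + t + 1 < p.length := by omega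
    have e2 : p.length + t + 1 ≠ p.length := by omega
    have e3 : ¬ p.length + t + 1 + m < p.length := by omega
    have e4 : p.length + t + 1 + m - (p.length + (m + 1)) = t := by omega
    have e5 : p.length + t + 1 - p.length = t + 1 := by omega
    have e6 : ¬ p.length + t + 1 + m < p.length + (m + 1) := by omega
    have e7 : ¬ p.length + t + 1 < p.length + 1 := by omega
    have e8 : p.length + t + 1 - (p.length + 1) = t := by omega
    simp only [substAt, e1, e2, if_false, List.getD_eq_getElem?_getD, List.getElem?_append,
      List.length_append, List.length_ofFn, List.length_singleton, e4, e6, e7, e8]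

/-- Two words are congruent if they have the same length modulo `m` and are interchangeable in
every context in which the `F`-product is defined. -/
def wordCon (m : ℕ) (F : (Fin (m + 1) → X) → X) (d : X) : Con (FreeMonoid X) where
  r u v := u.toList.length ≡ v.toList.length [MOD m] ∧ ∀ p q : List X,
    p.length + u.toList.length + q.length ≡ 1 [MOD m] →
      wordProd m F d (p ++ u.toList ++ q) = wordProd m F d (p ++ v.toList ++ q)
  iseqv := {
    refl := fun _ => ⟨rfl, fun _ _ _ => rfl⟩
    symm := fun h => ⟨h.1.symm, fun p q hpq =>
      (h.2 p q ((((h.1.add_left _).add_right _)).trans hpq)).symm⟩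
    trans := fun h h' => ⟨h.1.trans h'.1, fun p q hpq => (h.2 p q hpq).trans
      (h'.2 p q ((((h.1.symm.add_left _).add_right _)).trans hpq))⟩ }
  mul' := by
    rintro u v u' v' ⟨h1, h2⟩ ⟨h1', h2'⟩
    refine ⟨by simpa [FreeMonoid.toList_mul] using h1.add h1', fun p q hpq => ?_⟩
    simp only [FreeMonoid.toList_mul, List.length_append] at hpq ⊢
    have e1 := h2 p (u'.toList ++ q) (by
      simpa [add_assoc] using hpq)
    have e2 := h2' (p ++ v.toList) q (by
      refine Nat.ModEq.trans ?_ hpq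
      have := ((h1.symm.add_left p.length).add_right u'.toList.length).add_right q.length
      simpa [add_assoc] using this)
    simp only [List.append_assoc] at e1 e2 ⊢
    exact e1.trans e2

universe u

/-- An `n`-ary semigroup embeds into a monoid whose `n`-fold product extends the `n`-ary
operation. -/
theorem NAryAssociative.exists_covering_monoid {X : Type u} [Nonempty X] {m : ℕ}
    {F : (Fin (m + 1) → X) → X} (hF : NAryAssociative (m + 1) F) (hm : 0 < m) :
    ∃ (C : Type u) (_ : Monoid C) (ι : X → C), Function.Injective ι ∧
      ∀ x : Fin (m + 1) → X, ι (F x) = (List.ofFn fun i => ι (x i)).prod := by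
  obtain ⟨d⟩ := ‹Nonempty X›
  refine ⟨(wordCon m F d).Quotient, inferInstance, fun a => (FreeMonoid.of a : FreeMonoid X),
    fun a b hab => ?_, fun x => ?_⟩
  · have h := ((Con.eq _).1 hab).2 [] [] (by simp; rfl)
    simpa [wordProd, leftProd] using h
  · have : (List.ofFn fun i => ((FreeMonoid.of (x i) : FreeMonoid X) : (wordCon m F d).Quotient)) =
        ((List.ofFn x).map FreeMonoid.of).map (wordCon m F d).mk' := by
      rw [List.map_ofFn, List.map_ofFn]; rfl
    rw [this, ← map_list_prod]
    refine (Con.eq _).2 ?_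
    have hx : ((List.ofFn x).map FreeMonoid.of).prod = FreeMonoid.ofList (List.ofFn x) := by
      induction List.ofFn x with
      | nil => rfl
      | cons a l ih => rw [List.map_cons, List.prod_cons, ih, FreeMonoid.ofList_cons]
    rw [hx]
    refine (wordCon m F d).symm ⟨by simp [Nat.ModEq], fun p q hpq => ?_⟩
    refine hF.wordProd_append hm d p q x ?_
    simp only [FreeMonoid.toList_ofList, List.length_ofFn] at hpq
    have h := (Nat.modEq_iff_dvd' (show 1 ≤ p.length + (m + 1) + q.length by omega)).1 hpq.symm
    rw [show p.length + (m + 1) + q.length - 1 = m + (p.length + q.length) by omega] at h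
    exact (Nat.dvd_add_right (dvd_refl m)).1 h

end Covering

section TwinClass

variable {C : Type*} [Monoid C] {ι : X → C} {m : ℕ}

theorem mul_pow_eq_of_mul_eq_sq {u v : C} (h : u * v = u * u) (j : ℕ) :
    u * v ^ j = u ^ (j + 1) := by
  induction j with
  | zero => simp
  | succ j ih => rw [pow_succ' v, ← mul_assoc, h, mul_assoc, ih, ← pow_succ']

theorem mul_eq_sq_or_of_pow_ne (hm : 0 < m) (hpow : ∀ a, ι a ^ (m + 1) = ι a)
    (hl : ∀ a b, ι a ^ m * ι b = ι a ∨ ι a ^ m * ι b = ι b)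
    (hr : ∀ a b, ι b * ι a ^ m = ι a ∨ ι b * ι a ^ m = ι b)
    {a b : X} (hab : ι a ^ m ≠ ι b ^ m) :
    ι a * ι b = ι a * ι a ∨ ι a * ι b = ι b * ι b := by
  rcases hl a b with h | h
  · left
    rw [← hpow a, pow_succ', mul_assoc, h, ← pow_succ', hpow]
  rcases hr b a with h' | h'
  · right
    rw [← hpow b, pow_succ, ← mul_assoc, h', ← pow_succ, hpow]
  refine absurd ?_ hab
  obtain ⟨k, rfl⟩ : ∃ k, m = k + 1 := ⟨m - 1, by omega⟩
  have h1 : ι a ^ (k + 1) * ι b ^ (k + 1) = ι b ^ (k + 1) := by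
    rw [pow_succ' (ι b), ← mul_assoc, h]
  have h2 : ι a ^ (k + 1) * ι b ^ (k + 1) = ι a ^ (k + 1) := by
    conv_lhs => rw [pow_succ (ι a), mul_assoc, h']
    rw [← pow_succ]
  exact h2.symm.trans h1

theorem mul_comm_of_pow_eq (hm : 0 < m) (hpow : ∀ a, ι a ^ (m + 1) = ι a)
    (hc : ∀ a b, ι a * ι b * ι a ^ (m - 1) = ι a ∨ ι a * ι b * ι a ^ (m - 1) = ι b)
    {a b : X} (hab : ι a ^ m = ι b ^ m) : ι a * ι b = ι b * ι a := by
  obtain ⟨k, rfl⟩ : ∃ k, m = k + 1 := ⟨m - 1, by omega⟩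
  have key : ι a * ι b * ι a ^ k * ι a = ι a * ι b := by
    rw [mul_assoc _ _ (ι a), ← pow_succ, hab, mul_assoc, ← pow_succ', hpow]
  rcases hc a b with h | h
  · rw [Nat.add_sub_cancel] at h
    rw [h] at key
    have : ι a = ι b := by
      rw [← hpow b, pow_succ, ← hab, pow_succ, mul_assoc, ← key, ← pow_two, ← pow_add]
      exact (hpow a).symm
    rw [this]
  · rw [Nat.add_sub_cancel] at h
    rw [h] at key
    exact key.symm

theorem mul_eq_sq_of_pow_ne_of_twins (hm : 0 < m) (hpow : ∀ a, ι a ^ (m + 1) = ι a)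
    (hι : Function.Injective ι)
    (hl : ∀ a b, ι a ^ m * ι b = ι a ∨ ι a ^ m * ι b = ι b)
    (hr : ∀ a b, ι b * ι a ^ m = ι a ∨ ι b * ι a ^ m = ι b)
    {a b c : X} (hne : a ≠ b) (hab : ι a ^ m = ι b ^ m) (hc : ι c ^ m ≠ ι a ^ m) :
    ι a * ι c = ι c * ι c ∧ ι c * ι a = ι c * ι c := by
  have hac : ι a ≠ ι c := fun h => hc (by rw [h])
  have hab' : ι a ≠ ι b := fun h => hne (hι h)
  have h1 : ι a ^ m * ι c = ι c := by
    rcases hl a c with h | h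
    · rcases hl b c with h' | h'
      · rw [← hab, h] at h'
        exact absurd h' hab'
      · rw [hab, h']
    · exact h
  have h2 : ι c * ι a ^ m = ι c := by
    rcases hr a c with h | h
    · rcases hr b c with h' | h'
      · rw [← hab, h] at h'
        exact absurd h' hab'
      · rw [hab, h']
    · exact h
  obtain ⟨k, rfl⟩ : ∃ k, m = k + 1 := ⟨m - 1, by omega⟩
  constructor
  · refine (mul_eq_sq_or_of_pow_ne hm hpow hl hr hc.symm).resolve_left fun h => hac ?_
    rw [← h1, pow_succ, mul_assoc, h, ← pow_two, ← pow_add]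
    exact (hpow a).symm
  · refine (mul_eq_sq_or_of_pow_ne hm hpow hl hr hc).resolve_right fun h => hac ?_
    rw [← h2, pow_succ', ← mul_assoc, h, ← pow_two, ← pow_add, add_comm]
    exact (hpow a).symm

theorem prod_eq_pow_of_forall_mem {T : Set X}
    (hcross : ∀ t ∈ T, ∀ x ∉ T, ι t * ι x = ι x * ι x ∧ ι x * ι t = ι x * ι x)
    {x : X} (hx : x ∉ T) (l : List X) (hl : ∀ t ∈ l, t ∈ T) :
    ι x * (l.map ι).prod = ι x ^ (l.length + 1) := by
  induction l with
  | nil => simp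
  | cons t l ih =>
    simp only [List.mem_cons, forall_eq_or_imp] at hl
    rw [List.map_cons, List.prod_cons, ← mul_assoc, (hcross t hl.1 x hx).2, mul_assoc, ih hl.2,
      ← pow_succ', List.length_cons]

/-- A word with a letter outside `T` equals a power of one of its letters outside `T`. -/
theorem forall_mem_or_prod_eq_pow {T : Set X}
    (hcross : ∀ t ∈ T, ∀ x ∉ T, ι t * ι x = ι x * ι x ∧ ι x * ι t = ι x * ι x)
    (hout : ∀ x ∉ T, ∀ y ∉ T, ι x * ι y = ι x * ι x ∨ ι x * ι y = ι y * ι y)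
    (l : List X) :
    (∀ t ∈ l, t ∈ T) ∨ ∃ a ∈ l, a ∉ T ∧ (l.map ι).prod = ι a ^ l.length := by
  induction l with
  | nil => simp
  | cons x l ih =>
    rcases ih with h | ⟨a, hal, haT, ha⟩
    · by_cases hx : x ∈ T
      · left
        simpa [hx] using h
      · right
        exact ⟨x, by simp, hx, by simpa using prod_eq_pow_of_forall_mem hcross hx l h⟩
    · right
      obtain ⟨k, hk⟩ : ∃ k, l.length = k + 1 :=
        ⟨l.length - 1, by have := List.length_pos_of_mem hal; omega⟩
      have hxa : ι x * ι a = ι x * ι x ∧ x ∉ T ∨ ι x * ι a = ι a * ι a := by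
        by_cases hx : x ∈ T
        · exact Or.inr (hcross x hx a haT).1
        · exact (hout x hx a haT).imp_left fun h => ⟨h, hx⟩
      rcases hxa with ⟨h, hx⟩ | h
      · refine ⟨x, by simp, hx, ?_⟩
        rw [List.map_cons, List.prod_cons, ha, mul_pow_eq_of_mul_eq_sq h, List.length_cons]
      · refine ⟨a, by simp [hal], haT, ?_⟩
        rw [List.map_cons, List.prod_cons, ha, hk, pow_succ', ← mul_assoc, h, mul_assoc,
          ← pow_succ', ← pow_succ', List.length_cons, hk]

theorem prod_pow_eq_of_pow_eq {e : C} {l : List X}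
    (hcomm : ∀ a ∈ l, ∀ b ∈ l, ι a * ι b = ι b * ι a)
    (he : e * e = e) (hl : ∀ a ∈ l, ι a ^ m = e) (hne : l ≠ []) :
    (l.map ι).prod ^ m = e := by
  induction l with
  | nil => exact absurd rfl hne
  | cons a l ih =>
    simp only [List.mem_cons, forall_eq_or_imp] at hl hcomm
    have hca : Commute (ι a) (l.map ι).prod := by
      refine Commute.list_prod_right _ _ fun y hy => ?_
      obtain ⟨b, hb, rfl⟩ := List.mem_map.1 hy
      exact hcomm.1.2 b hb
    rw [List.map_cons, List.prod_cons, hca.mul_pow, hl.1]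
    rcases eq_or_ne l [] with rfl | hl'
    · simp
    · rw [ih (fun b hb c hc => (hcomm.2 b hb).2 c hc) hl.2 hl', he]

end TwinClass

section IterOp

variable {G : X → X → X}

theorem iterOp_add (hG : ∀ a b c, G (G a b) c = G a (G b c)) (p q : ℕ) (x : ℕ → X) :
    iterOp G (p + 1 + q) x = G (iterOp G p x) (iterOp G q fun i => x (i + (p + 1))) := by
  induction p generalizing x with
  | zero => simp [iterOp, Nat.add_comm 1 q]
  | succ p ih =>
    rw [show p + 1 + 1 + q = (p + 1 + q) + 1 by omega]
    simp only [iterOp, ih, hG]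
    simp only [Nat.add_assoc]

theorem iterOp_const (a : X) (k : ℕ) (x : ℕ → X) (hx : ∀ j ≤ k, x j = a) :
    iterOp G k x = gPow G a k := by
  induction k generalizing x with
  | zero => exact hx 0 le_rfl
  | succ k ih =>
    rw [iterOp, gPow, hx 0 (by omega), ih _ fun j hj => hx (j + 1) (by omega)]

/-- Substituting a product of `m + 1` consecutive letters into a word does not change the product
of the word. -/
theorem iterOp_subst (hG : ∀ a b c, G (G a b) c = G a (G b c)) (m k i : ℕ) (hi : i ≤ k)
    (x : ℕ → X) :
    iterOp G k (fun j => if j < i then x j else if j = i then iterOp G m (fun l => x (i + l))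
      else x (j + m)) = iterOp G (k + m) x := by
  induction k generalizing i x with
  | zero =>
    obtain rfl : i = 0 := by omega
    simp [iterOp]
  | succ k ih =>
    cases i with
    | zero =>
      rw [show k + 1 + m = m + 1 + k by omega, iterOp_add hG]
      simp [iterOp, Nat.add_assoc, Nat.add_comm 1]
    | succ i =>
      rw [show k + 1 + m = k + m + 1 by omega, iterOp, iterOp, ← ih i (by omega)]
      simp [Nat.add_assoc, Nat.add_comm, Nat.add_left_comm]

theorem NAryReducibleTo.associative {n : ℕ} {F : (Fin n → X) → X} (hF : NAryReducibleTo n F G)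
    (hn : 0 < n) (hG : ∀ a b c, G (G a b) c = G a (G b c)) : NAryAssociative n F := by
  have key (x : ℕ → X) (i : ℕ) (hi : i ≤ n - 1) :
      naryCompAt n F x i = iterOp G (n - 1 + (n - 1)) x := by
    rw [← iterOp_subst hG (n - 1) (n - 1) i hi, ← hF (fun l => x (i + l)), ← hF]
    unfold naryCompAt
    simp only [Nat.add_sub_assoc hn]
  intro x i hi
  rw [key x i (by omega), key x (i + 1) hi]

variable {n : ℕ} {Y : Set X}

theorem Cond15.iterOp_mem (h : Cond15 n G Y) (k : ℕ) (x : ℕ → X) (hx : ∀ j ≤ k, x j ∈ Y) :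
    iterOp G k x ∈ Y := by
  induction k generalizing x with
  | zero => exact hx 0 le_rfl
  | succ k ih => exact h.2.1.1 _ (hx 0 (by omega)) _ (ih _ fun j hj => hx (j + 1) (by omega))

theorem Cond15.exists_iterOp_eq (h : Cond15 n G Y) (k : ℕ) (x : ℕ → X) (hx : ∃ j ≤ k, x j ∉ Y) :
    ∃ j ≤ k, x j ∉ Y ∧ iterOp G k x = x j := by
  induction k generalizing x with
  | zero =>
    obtain ⟨j, hj, hjY⟩ := hx
    exact ⟨j, hj, hjY, by rw [show j = 0 by omega]; rfl⟩
  | succ k ih =>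
    by_cases htail : ∃ j ≤ k, x (j + 1) ∉ Y
    · obtain ⟨j, hj, hjY, hj'⟩ := ih (fun i => x (i + 1)) htail
      simp only [iterOp, hj']
      by_cases h0 : x 0 ∈ Y
      · exact ⟨j + 1, by omega, hjY, h.2.2.2 _ hjY _ (Or.inr h0) _ (Or.inl rfl) (Or.inr rfl)⟩
      · rcases h.2.2.1 _ h0 _ hjY with h' | h'
        · exact ⟨0, by omega, h0, h'⟩
        · exact ⟨j + 1, by omega, hjY, h'⟩
    · push Not at htail
      have h0 : x 0 ∉ Y := by
        obtain ⟨j, hj, hjY⟩ := hx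
        cases j with
        | zero => exact hjY
        | succ j => exact absurd (htail j (by omega)) hjY
      exact ⟨0, by omega, h0, h.2.2.2 _ h0 _ (Or.inl rfl) _
        (Or.inr (h.iterOp_mem k _ htail)) (Or.inl rfl)⟩

theorem Cond15.iterOp_eq (hG : ∀ a b c, G (G a b) c = G a (G b c)) (h : Cond15 n G Y)
    {a : X} (ha : a ∈ Y) (k p : ℕ) (hp : p ≤ k + 1) (x : ℕ → X) (hx : ∀ j ≤ k + 1, j ≠ p → x j = a)
    (hxp : x p ∈ Y) : iterOp G (k + 1) x = G (x p) (gPow G a k) := by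
  induction k generalizing p x with
  | zero =>
    rcases Nat.le_one_iff_eq_zero_or_eq_one.1 hp with rfl | rfl
    · simp [iterOp, gPow, hx 1]
    · have := hx 0 (by omega) (by omega)
      simp [iterOp, gPow, this, h.2.1.2.1 _ ha _ hxp]
  | succ k ih =>
    cases p with
    | zero =>
      rw [iterOp, iterOp_const a (k + 1) _ fun j hj => hx _ (by omega) (by omega)]
    | succ p =>
      rw [iterOp, ih p (by omega) (fun i => x (i + 1))
        (fun j hj hjp => hx _ (by omega) (by omega)) hxp,
        hx 0 (by omega) (by omega), ← hG, h.2.1.2.1 _ ha _ hxp, hG, gPow]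

theorem Cond15.apply_eq (hG : ∀ a b c, G (G a b) c = G a (G b c)) (h : Cond15 n G Y)
    (hn : 3 ≤ n) {F : (Fin n → X) → X} (hF : NAryReducibleTo n F G)
    {a : X} (ha : a ∈ Y) (x : Fin n → X) (p : Fin n) (hx : ∀ j, j ≠ p → x j = a)
    (hxp : x p ∈ Y) : F x = x p := by
  obtain ⟨k, rfl⟩ : ∃ k, n = k + 2 := ⟨n - 2, by omega⟩
  have h1 := hF fun j => if hj : j < k + 2 then x ⟨j, hj⟩ else a
  simp only [Fin.is_lt, dite_true, Fin.eta] at h1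
  have hp : (p : ℕ) < k + 2 := p.2
  rw [h1, show k + 2 - 1 = k + 1 from rfl, h.iterOp_eq hG ha k p (by omega)]
  · simp only [hp, dite_true, Fin.eta]
    obtain ⟨_, hcomm, _, e, he, hone, _, hexp⟩ := h.2.1
    have := hexp a ha
    rw [show k + 2 - 1 - 1 = k from rfl] at this
    rw [this, hcomm _ hxp _ he, hone _ hxp]
  · intro j hj hjp
    rw [dif_pos (by omega)]
    exact hx _ fun h => hjp (by rw [← h])
  · simpa [hp] using hxp

theorem Cond15.exists_apply_eq (h : Cond15 n G Y) {F : (Fin n → X) → X}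
    (hF : NAryReducibleTo n F G) (x : Fin n → X) (hx : ∃ j, x j ∉ Y) :
    ∃ j, x j ∉ Y ∧ F x = x j := by
  obtain ⟨j₀, hj₀⟩ := hx
  have hj₀n := j₀.2
  have h1 := hF fun j => if hj : j < n then x ⟨j, hj⟩ else x j₀
  simp only [Fin.is_lt, dite_true, Fin.eta] at h1
  obtain ⟨j, hj, hjY, hj'⟩ := h.exists_iterOp_eq (n - 1)
    (fun j => if hj : j < n then x ⟨j, hj⟩ else x j₀) ⟨j₀, by omega, by simpa using hj₀⟩
  have hjn : j < n := by omega
  simp only [hjn, dite_true] at hjY hj'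
  exact ⟨⟨j, hjn⟩, hjY, h1.trans hj'⟩

theorem Cond15.eq_naryNeutralSet (hG : ∀ a b c, G (G a b) c = G a (G b c)) (h : Cond15 n G Y)
    (hn : 3 ≤ n) {F : (Fin n → X) → X} (hF : NAryReducibleTo n F G) : Y = naryNeutralSet n F := by
  ext e
  constructor
  · intro he a p
    by_cases ha : a ∈ Y
    · simpa using h.apply_eq hG hn hF he (Function.update (fun _ => e) p a) p
        (fun j hj => by simp [hj]) (by simpa using ha)
    · obtain ⟨j, hj, hj'⟩ := h.exists_apply_eq hF (Function.update (fun _ => e) p a)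
        ⟨p, by simpa using ha⟩
      rcases eq_or_ne j p with rfl | hjp
      · simpa using hj'
      · simp [hjp, he] at hj
  · intro he
    by_contra heY
    obtain ⟨_, _, _, t, ht, _⟩ := h.2.1
    have h0 := he t ⟨0, by omega⟩
    obtain ⟨j, hj, hj'⟩ := h.exists_apply_eq hF (Function.update (fun _ => e) ⟨0, by omega⟩ t)
        ⟨⟨1, by omega⟩, by simpa [Function.update] using heY⟩
    rw [← hj', h0] at hj
    exact hj ht

theorem MemD.exists_forall_ne {x : Fin n → X} (hn : 3 ≤ n) (hx : MemD n (n - 1) x) :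
    ∃ (a : X) (p : Fin n), a ∈ Set.range x ∧ ∀ j, j ≠ p → x j = a := by
  obtain ⟨S, hS, hSx⟩ := hx
  obtain ⟨i, hi⟩ : S.Nonempty := Finset.card_pos.1 (by omega)
  have hcompl : Sᶜ.card ≤ 1 := by
    rw [Finset.card_compl, Fintype.card_fin]; omega
  by_cases hemp : Sᶜ.Nonempty
  · obtain ⟨p, hp⟩ := hemp
    refine ⟨x i, p, ⟨i, rfl⟩, fun j hj => hSx j ?_ i hi⟩
    by_contra hjS
    exact hj (Finset.card_le_one.1 hcompl j (by simpa using hjS) p hp)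
  · rw [Finset.not_nonempty_iff_eq_empty, Finset.compl_eq_empty_iff] at hemp
    exact ⟨x i, i, ⟨i, rfl⟩, fun j _ => hSx j (by simp [hemp]) i hi⟩

theorem Cond15.quasitrivialOnD (hG : ∀ a b c, G (G a b) c = G a (G b c)) (h : Cond15 n G Y)
    (hn : 3 ≤ n) {F : (Fin n → X) → X} (hF : NAryReducibleTo n F G) :
    NAryQuasitrivialOnD n (n - 1) F := by
  intro x hx
  by_cases hY : ∃ j, x j ∉ Y
  · obtain ⟨j, -, hj⟩ := h.exists_apply_eq hF x hY
    exact ⟨j, hj.symm⟩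
  · push Not at hY
    obtain ⟨_, p, ⟨i, rfl⟩, hp⟩ := hx.exists_forall_ne hn
    exact ⟨p, (h.apply_eq hG hn hF (hY i) x p hp (hY p)).symm⟩

theorem Cond15.not_quasitrivial (h : Cond15 n G Y)
    (hn : 3 ≤ n) {F : (Fin n → X) → X} (hF : NAryReducibleTo n F G) :
    ¬ NAryQuasitrivial n F := by
  obtain ⟨hmem, hcomm, hassoc, e, he, hone, hinv, -⟩ := h.2.1
  have hone' (a) (ha : a ∈ Y) : G a e = a := by rw [hcomm _ ha _ he, hone _ ha]
  have hcancel (a) (ha : a ∈ Y) (b) (hb : b ∈ Y) (c) (hc : c ∈ Y) (habc : G a b = G a c) :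
      b = c := by
    obtain ⟨d, hd, had⟩ := hinv a ha
    rw [hcomm _ ha _ hd] at had
    rw [← hone b hb, ← hone c hc, ← had, hassoc _ hd _ ha _ hb, hassoc _ hd _ ha _ hc, habc]
  obtain ⟨a, ha, b, hb, hae, hbe, hab⟩ :
      ∃ a ∈ Y, ∃ b ∈ Y, a ≠ e ∧ b ≠ e ∧ G a b ≠ e := by
    obtain ⟨a, b, c, ha, hb, hc, hab, hac, hbc⟩ :
        ∃ a b c, a ∈ Y ∧ b ∈ Y ∧ c ∈ Y ∧ a ≠ b ∧ a ≠ c ∧ b ≠ c := by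
      obtain ⟨S, hSY, hS⟩ := Set.exists_subset_encard_eq h.1
      obtain ⟨a, b, c, hab, hac, hbc, rfl⟩ := Set.encard_eq_three.1 hS
      exact ⟨a, b, c, hSY (by simp), hSY (by simp), hSY (by simp), hab, hac, hbc⟩
    obtain ⟨u, v, hu, hv, hue, hve, huv⟩ : ∃ u v, u ∈ Y ∧ v ∈ Y ∧ u ≠ e ∧ v ≠ e ∧ u ≠ v := by
      rcases eq_or_ne a e with rfl | hae
      · exact ⟨b, c, hb, hc, hab.symm, hac.symm, hbc⟩
      rcases eq_or_ne b e with rfl | hbe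
      · exact ⟨a, c, ha, hc, hae, hbc.symm, hac⟩
      exact ⟨a, b, ha, hb, hae, hbe, hab⟩
    by_cases huu : G u u = e
    · exact ⟨u, hu, v, hv, hue, hve, fun h' => huv (hcancel u hu u hu v hv (huu.trans h'.symm))⟩
    · exact ⟨u, hu, u, hu, hue, hue, huu⟩
  intro hq
  obtain ⟨k, rfl⟩ : ∃ k, n = k + 3 := ⟨n - 3, by omega⟩
  have hpow (j : ℕ) : gPow G e j = e := by
    induction j with
    | zero => rfl
    | succ j ih => rw [gPow, ih, hone e he]
  let x : ℕ → X := fun j => if j = 0 then a else if j = 1 then b else e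
  have hx : F (fun i : Fin (k + 3) => x i) = G a b := by
    rw [hF x, show k + 3 - 1 = k + 1 + 1 from rfl, iterOp, iterOp,
      iterOp_const e k _ (by intro j _; simp [x]), hpow]
    simp [x, hone' b hb]
  obtain ⟨j, hj⟩ := hq fun i : Fin (k + 3) => x i
  rw [hx] at hj
  simp only [x] at hj
  split_ifs at hj
  · exact hbe (hcancel a ha b hb e he (by rw [hone' a ha, ← hj]))
  · exact hae (hcancel b hb a ha e he (by rw [hone' b hb, hcomm b hb a ha, ← hj]))
  · exact hab hj.symm

end IterOp

section Reduction

theorem NAryQuasitrivialOnD.pow_mul_mul_pow {C : Type*} [Monoid C] {ι : X → C} {m : ℕ}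
    {F : (Fin (m + 1) → X) → X} (hD : NAryQuasitrivialOnD (m + 1) m F)
    (hF : ∀ x : Fin (m + 1) → X, ι (F x) = (List.ofFn fun i => ι (x i)).prod)
    (a b : X) {i j : ℕ} (hij : i + j = m) :
    ι a ^ i * ι b * ι a ^ j = ι a ∨ ι a ^ i * ι b * ι a ^ j = ι b := by
  subst hij
  let l : List X := List.replicate i a ++ b :: List.replicate j a
  have hl : l.length = i + j + 1 := by simp [l, Nat.add_assoc]
  let x : Fin (i + j + 1) → X := fun k => l[(k : ℕ)]'(by rw [hl]; exact k.2)
  have hx : (List.ofFn fun k => ι (x k)) = l.map ι := by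
    apply List.ext_getElem
    · simp [hl]
    · intro k h1 h2
      simp [x, -List.ofFn_succ]
  have hmem : MemD (i + j + 1) (i + j) x := by
    refine ⟨Finset.univ.erase ⟨i, by omega⟩, by simp, ?_⟩
    have (k : Fin (i + j + 1)) (hk : k ∈ Finset.univ.erase (⟨i, by omega⟩ : Fin (i + j + 1))) :
        x k = a := by
      have hki : (k : ℕ) ≠ i := fun h => (Finset.ne_of_mem_erase hk) (Fin.ext h)
      rcases lt_or_gt_of_ne hki with h | h
      · simp [x, l, List.getElem_append, h]
      · obtain ⟨t, ht⟩ := Nat.exists_eq_add_of_lt h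
        simp [x, l, List.getElem_append, ht, Nat.add_assoc]
    intro k hk k' hk'
    rw [this k hk, this k' hk']
  have hprod := hF x
  rw [hx] at hprod
  simp only [l, List.map_append, List.map_cons, List.map_replicate, List.prod_append,
    List.prod_cons, List.prod_replicate, ← mul_assoc] at hprod
  rw [← hprod]
  obtain ⟨k, hk⟩ := hD x hmem
  have hxl : x k ∈ l := List.getElem_mem _
  rw [hk] at hxl
  simp only [l, List.mem_append, List.mem_replicate, List.mem_cons] at hxl
  rcases hxl with h | h | h
  · exact Or.inl (by rw [h.2])
  · exact Or.inr (by rw [h])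
  · exact Or.inl (by rw [h.2])

theorem map_iterOp {C : Type*} [Monoid C] {ι : X → C} {G : X → X → X} {f : C}
    (hG : ∀ u v, ι (G u v) = ι u * ι v * f) (k : ℕ) (x : ℕ → X) :
    ι (iterOp G k x) = (List.ofFn fun i : Fin (k + 1) => ι (x i)).prod * f ^ k := by
  induction k generalizing x with
  | zero => simp [iterOp]
  | succ k ih =>
    rw [iterOp, hG, ih, List.ofFn_succ, List.prod_cons, pow_succ]
    simp [mul_assoc]

theorem map_gPow {C : Type*} [Monoid C] {ι : X → C} {G : X → X → X} {f : C}
    (hG : ∀ u v, ι (G u v) = ι u * ι v * f) (a : X) (k : ℕ) :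
    ι (gPow G a k) = ι a ^ (k + 1) * f ^ k := by
  induction k with
  | zero => simp [gPow]
  | succ k ih => rw [gPow, hG, ih, pow_succ' (ι a) (k + 1), pow_succ f]; simp only [mul_assoc]

theorem NAryAssociative.exists_reduction {m : ℕ} [Nonempty X] {F : (Fin (m + 1) → X) → X}
    (hF : NAryAssociative (m + 1) F) (hm : 0 < m)
    (hD : NAryQuasitrivialOnD (m + 1) m F) (hQ : ¬ NAryQuasitrivial (m + 1) F) :
    ∃ G : X → X → X, (∀ a b c, G (G a b) c = G a (G b c)) ∧
      NAryReducibleTo (m + 1) F G ∧ ∃ Y : Set X, Cond15 (m + 1) G Y := by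
  obtain ⟨C, _, ι, hι, hprod⟩ := hF.exists_covering_monoid hm
  have hgen (a b : X) {i j : ℕ} (hij : i + j = m) := hD.pow_mul_mul_pow hprod a b hij
  have hpow (a : X) : ι a ^ (m + 1) = ι a := by
    simpa [pow_succ] using hgen a a (Nat.add_zero m)
  have hl (a b : X) : ι a ^ m * ι b = ι a ∨ ι a ^ m * ι b = ι b := by
    simpa using hgen a b (Nat.add_zero m)
  have hr (a b : X) : ι b * ι a ^ m = ι a ∨ ι b * ι a ^ m = ι b := by
    simpa using hgen a b (Nat.zero_add m)
  have hc (a b : X) : ι a * ι b * ι a ^ (m - 1) = ι a ∨ ι a * ι b * ι a ^ (m - 1) = ι b := by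
    simpa using hgen a b (show 1 + (m - 1) = m by omega)
  obtain ⟨x, hx⟩ := not_forall.1 hQ
  have hword (T : Set X)
      (hcross : ∀ t ∈ T, ∀ x ∉ T, ι t * ι x = ι x * ι x ∧ ι x * ι t = ι x * ι x)
      (hout : ∀ x ∉ T, ∀ y ∉ T, ι x * ι y = ι x * ι x ∨ ι x * ι y = ι y * ι y) (j) : x j ∈ T := by
    rcases forall_mem_or_prod_eq_pow hcross hout (List.ofFn x) with h | ⟨a, ha, -, h⟩
    · exact h _ (List.mem_ofFn.2 ⟨j, rfl⟩)
    · rw [List.map_ofFn, List.length_ofFn, hpow] at h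
      have : F x = a := hι ((hprod x).trans h)
      exact absurd (this ▸ List.mem_ofFn.1 ha) hx
  obtain ⟨a, b, hne, hab⟩ : ∃ a b, a ≠ b ∧ ι a ^ m = ι b ^ m := by
    by_contra! h
    refine hword ∅ (by simp) (fun u _ v _ => ?_) 0
    rcases eq_or_ne u v with rfl | huv
    · exact Or.inl rfl
    · exact mul_eq_sq_or_of_pow_ne hm hpow hl hr (h u v huv)
  let T : Set X := {t | ι t ^ m = ι a ^ m}
  have hcross (t) (ht : t ∈ T) (x) (hx : x ∉ T) : ι t * ι x = ι x * ι x ∧ ι x * ι t = ι x * ι x := by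
    have hxt : ι x ^ m ≠ ι t ^ m := fun h => hx (h.trans ht)
    rcases eq_or_ne t a with rfl | hta
    · exact mul_eq_sq_of_pow_ne_of_twins hm hpow hι hl hr hne hab hxt
    · exact mul_eq_sq_of_pow_ne_of_twins hm hpow hι hl hr hta ht hxt
  have haT : a ∈ T := rfl
  have hout (u) (hu : u ∉ T) (v) (hv : v ∉ T) :
      ι u * ι v = ι u * ι u ∨ ι u * ι v = ι v * ι v := by
    rcases eq_or_ne u v with rfl | huv
    · exact Or.inl rfl
    refine mul_eq_sq_or_of_pow_ne hm hpow hl hr fun huv' => hu ?_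
    have h1 := (mul_eq_sq_of_pow_ne_of_twins hm hpow hι hl hr huv huv'
      (fun h => hu h.symm : ι a ^ m ≠ ι u ^ m)).2
    have h2 : ι a * ι u ^ m = ι u := by
      rw [← Nat.sub_add_cancel hm, pow_succ', ← mul_assoc, (hcross a haT u hu).1, mul_assoc,
        ← pow_succ', Nat.sub_add_cancel hm, ← pow_succ', hpow]
    rw [mul_pow_eq_of_mul_eq_sq h1, hpow] at h2
    exact congrArg (· ^ m) h2.symm
  have hcommT (u) (hu : u ∈ T) (v) (hv : v ∈ T) : ι u * ι v = ι v * ι u :=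
    mul_comm_of_pow_eq hm hpow hc (hu.trans hv.symm)
  have hcomm (u) : Commute (ι a) (ι u) := by
    by_cases hu : u ∈ T
    · exact hcommT a haT u hu
    · exact (hcross a haT u hu).1.trans (hcross a haT u hu).2.symm
  have hone (u) : ι u * ι a ^ m = ι u := by
    by_cases hu : u ∈ T
    · rw [← show ι u ^ m = ι a ^ m from hu, ← pow_succ', hpow]
    · rw [mul_pow_eq_of_mul_eq_sq (hcross a haT u hu).2, hpow]
  have hone' (u) (j : ℕ) : ι u * (ι a ^ m) ^ j = ι u := by
    induction j with
    | zero => simp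
    | succ j ih => rw [pow_succ', ← mul_assoc, hone, ih]
  have hclosed (l : List X) (hl : ∀ t ∈ l, t ∈ T) (hne : l ≠ []) (c : X)
      (hcl : ι c = (l.map ι).prod) : c ∈ T := by
    change ι c ^ m = ι a ^ m
    rw [hcl]
    refine prod_pow_eq_of_pow_eq (fun u hu v hv => hcommT u (hl u hu) v (hl v hv)) ?_ hl hne
    obtain ⟨k, rfl⟩ : ∃ k, m = k + 1 := ⟨m - 1, by omega⟩
    nth_rewrite 1 [pow_succ]
    rw [mul_assoc, hone, ← pow_succ]
  have hlist (l : List X) (hlen : l.length = m + 1) : ∃ c, ι c = (l.map ι).prod := by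
    refine ⟨F fun i => l[(i : ℕ)], ?_⟩
    rw [hprod]
    congr 1
    apply List.ext_getElem
    · simp [hlen]
    · intro k h1 h2
      simp [-List.ofFn_succ]
  have hT : 3 ≤ T.encard := by
    have hxT := hword T hcross hout
    have hFT : F x ∈ T := hclosed (List.ofFn x)
      (fun t ht => by obtain ⟨j, rfl⟩ := List.mem_ofFn.1 ht; exact hxT j) (by simp) _
      (by rw [hprod, List.map_ofFn]; rfl)
    obtain ⟨j, hj⟩ : ∃ j, x j ≠ x 0 := by
      by_contra! h
      refine hx ⟨0, hι ?_⟩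
      rw [hprod]
      simp only [h, List.ofFn_const, List.prod_replicate, hpow]
    have hsub : {x j, x 0, F x} ⊆ T := by
      rintro t (rfl | rfl | rfl)
      exacts [hxT j, hxT 0, hFT]
    rw [← Set.encard_eq_three.2 ⟨x j, x 0, F x, hj, fun h => hx ⟨j, h⟩, fun h => hx ⟨0, h⟩, rfl⟩]
    exact Set.encard_le_encard hsub
  have hGex (u v : X) : ∃ w, ι w = ((u :: v :: List.replicate (m - 1) a).map ι).prod :=
    hlist _ (by simp; omega)
  choose G hG' using hGex
  set f := ι a ^ (m - 1) with hf
  have hG (u v : X) : ι (G u v) = ι u * ι v * f := by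
    rw [hG', List.map_cons, List.map_cons, List.prod_cons, List.prod_cons, List.map_replicate,
      List.prod_replicate, mul_assoc]
  have hfcomm (u) : f * ι u = ι u * f := ((hcomm u).pow_left (m - 1)).eq
  have haf : ι a * f = ι a ^ m := by rw [hf, ← pow_succ', Nat.sub_add_cancel hm]
  have hsq (u) (hu : u ∉ T) : ι u * ι u * f = ι u := by
    rw [mul_assoc, hf, mul_pow_eq_of_mul_eq_sq (hcross a haT u hu).2, Nat.sub_add_cancel hm,
      ← pow_succ', hpow]
  refine ⟨G, fun u v w => hι ?_, fun y => hι ?_, T, hT, ⟨?_, ?_, ?_, a, haT, ?_, ?_, ?_⟩, ?_, ?_⟩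
  · rw [hG, hG, hG, hG]
    simp only [mul_assoc, ← hfcomm w]
  · rw [Nat.add_sub_cancel, map_iterOp hG, ← hprod, hf, ← pow_mul, mul_comm, pow_mul, hone']
  · exact fun u hu v hv => hclosed _ (by simp; tauto) (by simp) _ (hG' u v)
  · exact fun u hu v hv => hι (by rw [hG, hG, hcommT u hu v hv])
  · intro u _ v _ w _
    apply hι
    rw [hG, hG, hG, hG]
    simp only [mul_assoc, ← hfcomm w]
  · intro u _
    apply hι
    rw [hG, (hcomm u).eq, mul_assoc, haf, hone]
  · intro t ht
    obtain ⟨c, hc⟩ := hlist (List.replicate (m - 1) t ++ [a, a]) (by simp; omega)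
    refine ⟨c, hclosed _ ?_ (by simp) c hc, hι ?_⟩
    · intro s hs
      simp only [List.mem_append, List.mem_replicate, List.mem_cons, List.not_mem_nil, or_false,
        or_self] at hs
      rcases hs with hs | rfl
      · exact hs.2 ▸ ht
      · exact haT
    · have hta : ι t * ι t ^ (m - 1) = ι a ^ m := by
        rw [← pow_succ', Nat.sub_add_cancel hm]; exact ht
      rw [hG, hc]
      simp only [List.map_append, List.map_replicate, List.prod_append, List.prod_replicate,
        List.map_cons, List.map_nil, List.prod_cons, List.prod_nil, mul_one]
      rw [← mul_assoc, hta, ← mul_assoc, mul_assoc _ _ f, haf, ← pow_succ, hpow, hone]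
  · intro t ht
    apply hι
    rw [Nat.add_sub_cancel, map_gPow hG, Nat.sub_add_cancel hm, show ι t ^ m = ι a ^ m from ht]
    obtain ⟨k, rfl⟩ : ∃ k, m = k + 1 := ⟨m - 1, by omega⟩
    rw [hf, Nat.add_sub_cancel, ← pow_mul, ← pow_add,
      show k + 1 + k * k = 1 + (k + 1) * k by ring, pow_add, pow_one, pow_mul, hone']
  · intro u hu v hv
    have : ι (G u v) = ι u ^ m * ι v := by
      rw [hG, mul_assoc, ← hfcomm, ← mul_assoc, hf,
        mul_pow_eq_of_mul_eq_sq (hcross a haT u hu).2, Nat.sub_add_cancel hm]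
    rcases hl u v with h | h
    · exact Or.inl (hι (this.trans h))
    · exact Or.inr (hι (this.trans h))
  · intro u hu v hv w hw hvw
    apply hι
    rw [hG]
    rcases hv with rfl | hv
    · rcases hw with rfl | hw
      · exact hsq _ hu
      · rw [(hcross w hw _ hu).2, hsq _ hu]
    · obtain rfl : w = u := hvw.resolve_left fun h => hu (h ▸ hv)
      rw [(hcross v hv _ hu).1, hsq _ hu]

end Reduction

/-- Characterization of `𝓕ⁿ_{n-1} \ 𝓕ⁿ₁` via binary reductions: assuming this class is
nonempty, `F` is associative, quasitrivial on `D^n_{n-1}` and not quasitrivial iff `F` is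
reducible to an associative binary operation `G` for which there is a unique subset
`Y ⊆ X` with `|Y| ≥ 3` satisfying (a), (b), (c); moreover `Y = E_F`. -/
theorem stmt_15 {X : Type*} [Nonempty X] (n : ℕ) (hn : 3 ≤ n)
    (hne : ∃ F₀ : (Fin n → X) → X, NAryAssociative n F₀ ∧
      NAryQuasitrivialOnD n (n - 1) F₀ ∧ ¬NAryQuasitrivial n F₀)
    (F : (Fin n → X) → X) :
    ((NAryAssociative n F ∧ NAryQuasitrivialOnD n (n - 1) F ∧ ¬NAryQuasitrivial n F) ↔
      ∃ G : X → X → X, (∀ a b c, G (G a b) c = G a (G b c)) ∧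
        NAryReducibleTo n F G ∧ ∃! Y : Set X, Cond15 n G Y) ∧
    ((NAryAssociative n F ∧ NAryQuasitrivialOnD n (n - 1) F ∧ ¬NAryQuasitrivial n F) →
      ∀ G : X → X → X, (∀ a b c, G (G a b) c = G a (G b c)) →
        NAryReducibleTo n F G → ∀ Y : Set X, Cond15 n G Y → Y = naryNeutralSet n F) := by
  have hback : (∃ G : X → X → X, (∀ a b c, G (G a b) c = G a (G b c)) ∧
      NAryReducibleTo n F G ∧ ∃! Y : Set X, Cond15 n G Y) → NAryAssociative n F ∧
        NAryQuasitrivialOnD n (n - 1) F ∧ ¬NAryQuasitrivial n F := by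
    rintro ⟨G, hG, hF, Y, hY, -⟩
    exact ⟨hF.associative (by omega) hG, hY.quasitrivialOnD hG hn hF, hY.not_quasitrivial hn hF⟩
  refine ⟨⟨fun ⟨hA, hD, hQ⟩ => ?_, hback⟩,
    fun _ G hG hF Y hY => hY.eq_naryNeutralSet hG hn hF⟩
  obtain ⟨m, rfl⟩ : ∃ m, n = m + 1 := ⟨n - 1, by omega⟩
  obtain ⟨G, hG, hF, Y, hY⟩ := hA.exists_reduction (by omega) hD hQ
  exact ⟨G, hG, hF, Y, hY, fun Z hZ =>
    (hZ.eq_naryNeutralSet hG hn hF).trans (hY.eq_naryNeutralSet hG hn hF).symm⟩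
end

section
/- Let X be a nonempty set and n ≥ 3, and assume that either (n = 3 and |X| ≥ 4) or (n ≥ 4 and |X| ≥ n-1). Then there exists an associative operation F : X^n → X that is quasitrivial on D^n_{n-1} but not quasitrivial; that is, the inclusion of the class of quasitrivial associative n-ary operations on X into the class of associative n-ary operations on X that are quasitrivial on D^n_{n-1} is strict. -/
variable {X : Type*}

/-- The disjoint union of a monoid `A` and a type `Z` of left zeros on which `A` acts trivially. -/
inductive LeftZeroExtension (A Z : Type*)
  | inl : A → LeftZeroExtension A Z
  | inr : Z → LeftZeroExtension A Z

namespace LeftZeroExtension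

variable {A Z : Type*}

instance [Monoid A] : Monoid (LeftZeroExtension A Z) where
  mul
    | inl a, inl b => inl (a * b)
    | inl _, inr z => inr z
    | inr z, _ => inr z
  one := inl 1
  mul_assoc := by
    rintro (a | z) (b | w) (c | v)
    · exact congrArg inl (mul_assoc a b c)
    all_goals rfl
  one_mul := by
    rintro (a | z)
    · exact congrArg inl (one_mul a)
    · rfl
  mul_one := by
    rintro (a | z)
    · exact congrArg inl (mul_one a)
    · rfl

/-- The inclusion of `A` as a monoid homomorphism. -/
def inlHom [Monoid A] : A →* LeftZeroExtension A Z where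
  toFun := inl
  map_one' := rfl
  map_mul' _ _ := rfl

/-- `LeftZeroExtension A Z` is the sum type `A ⊕ Z`. -/
def equivSum : A ⊕ Z ≃ LeftZeroExtension A Z where
  toFun := Sum.elim inl inr
  invFun
    | inl a => Sum.inl a
    | inr z => Sum.inr z
  left_inv := by rintro (a | z) <;> rfl
  right_inv := by rintro (a | z) <;> rfl

theorem inlHom_injective [Monoid A] :
    Function.Injective (inlHom : A →* LeftZeroExtension A Z) :=
  fun _ _ h => inl.inj h

theorem exists_inr_mem_prod_eq [Monoid A] {l : List (LeftZeroExtension A Z)}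
    (h : ∃ z, inr z ∈ l) : ∃ z, inr z ∈ l ∧ l.prod = inr z := by
  induction l with
  | nil => simp at h
  | cons x t ih =>
    rw [List.prod_cons]
    rcases x with a | w
    · obtain ⟨z, hz⟩ := ih (by simpa using h)
      exact ⟨z, List.mem_cons_of_mem _ hz.1, by rw [hz.2]; rfl⟩
    · exact ⟨w, List.mem_cons_self, rfl⟩

/-- The `n`-ary product is quasitrivial on `D^n_{n-1}` as soon as the exponent of `A` divides
`n - 1`. -/
theorem quasitrivialOnD [CommMonoid A] {n : ℕ} (hn : n ≠ 0)
    (hA : ∀ a : A, a ^ (n - 1) = 1) :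
    NAryQuasitrivialOnD n (n - 1)
      (fun x : Fin n → LeftZeroExtension A Z => (List.ofFn x).prod) := by
  rintro x ⟨S, hS, hx⟩
  by_cases h : ∃ z, inr z ∈ List.ofFn x
  · obtain ⟨z, hz, hp⟩ := exists_inr_mem_prod_eq h
    rw [← hp] at hz
    exact List.mem_ofFn.1 hz
  have hg : ∀ i, ∃ a : A, x i = inlHom a := fun i => by
    rcases hi : x i with a | z
    · exact ⟨a, rfl⟩
    · exact absurd ⟨z, List.mem_ofFn.2 ⟨i, hi⟩⟩ h
  choose g hg using hg
  obtain rfl : x = inlHom ∘ g := funext hg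
  suffices ∃ j, ∏ i, g i = g j by
    obtain ⟨j, hj⟩ := this
    refine ⟨j, ?_⟩
    rw [Function.comp_apply, ← hj, ← List.prod_ofFn, map_list_prod, List.map_ofFn]
  have hc : ∀ i ∈ S, ∀ j ∈ S, g i = g j := fun i hi j hj => inlHom_injective (hx i hi j hj)
  obtain ⟨p, hp⟩ : ∃ p, ∀ i ≠ p, i ∈ S := by
    by_cases h' : ∃ p, p ∉ S
    · obtain ⟨p, hp⟩ := h'
      refine ⟨p, fun i hip => by_contra fun hi => ?_⟩
      have := Finset.card_le_univ (insert i (insert p S))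
      rw [Finset.card_insert_of_notMem (by simp [hip, hi]), Finset.card_insert_of_notMem hp,
        Fintype.card_fin] at this
      omega
    · push Not at h'
      exact ⟨⟨0, by omega⟩, fun i _ => h' i⟩
  obtain ⟨c, hc⟩ : ∃ c, ∀ i ∈ S, g i = c := by
    rcases S.eq_empty_or_nonempty with rfl | ⟨j, hj⟩
    · exact ⟨1, by simp⟩
    · exact ⟨g j, fun i hi => hc i hi j hj⟩
  refine ⟨p, ?_⟩
  rw [← Finset.mul_prod_erase _ _ (Finset.mem_univ p),
    Finset.prod_eq_pow_card fun i hi => hc i (hp i (Finset.ne_of_mem_erase hi)),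
    Finset.card_erase_of_mem (Finset.mem_univ p), Finset.card_univ, Fintype.card_fin, hA, mul_one]

end LeftZeroExtension

theorem prod_ofFn_eq_prod_map_range {M : Type*} [Monoid M] (n : ℕ) (x : ℕ → M) :
    (List.ofFn fun i : Fin n => x i).prod = ((List.range n).map x).prod := by
  congr 1
  exact List.ext_getElem (by simp) (by simp)

/-- The `n`-ary product of a monoid is associative. -/
theorem nAryAssociative_prod {M : Type*} [Monoid M] (n : ℕ) :
    NAryAssociative n (fun x : Fin n → M => (List.ofFn x).prod) := by
  have key : ∀ (x : ℕ → M) (i r : ℕ), n = i + 1 + r →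
      naryCompAt n (fun x : Fin n → M => (List.ofFn x).prod) x i =
        ((List.range (i + n + r)).map x).prod := by
    intro x i r hr
    have hy := prod_ofFn_eq_prod_map_range n fun j => if j < i then x j
      else if j = i then (List.ofFn fun k : Fin n => x (i + k)).prod else x (j + n - 1)
    refine hy.trans ?_
    rw [prod_ofFn_eq_prod_map_range n fun k => x (i + k)]
    conv_lhs => enter [1, 2]; rw [hr]
    simp only [List.range_add, List.map_append, List.prod_append, List.map_map]
    congr 2
    · congr 1
      refine List.map_congr_left fun j hj => ?_
      rw [if_pos (List.mem_range.1 hj)]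
    · simp [Function.comp_def]
    · refine List.map_congr_left fun j _ => ?_
      simp only [Function.comp_apply]
      rw [if_neg (by omega), if_neg (by omega)]
      congr 1
      omega
  intro x i hi
  rw [key x i (n - i - 1) (by omega), key x (i + 1) (n - i - 2) (by omega)]
  congr 3
  omega

/-- An embedded commutative monoid `A` whose exponent divides `n - 1`, with two elements whose
product differs from both of them and from `1`, yields an `n`-ary associative operation that is
quasitrivial on `D^n_{n-1}` but not quasitrivial. -/
theorem exists_not_quasitrivial_of_embedding {X A : Type*} [CommMonoid A] (f : A ↪ X) {n : ℕ}
    (hn : 2 ≤ n) (hA : ∀ a : A, a ^ (n - 1) = 1) {a b : A} (h₁ : a * b ≠ 1) (ha : a * b ≠ a)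
    (hb : a * b ≠ b) :
    ∃ F : (Fin n → X) → X, NAryAssociative n F ∧
      NAryQuasitrivialOnD n (n - 1) F ∧ ¬NAryQuasitrivial n F := by
  classical
  let e : X ≃ LeftZeroExtension A ↥(Set.range f)ᶜ :=
    ((Equiv.Set.sumCompl (Set.range f)).symm.trans
      (Equiv.sumCongr (Equiv.ofInjective f f.injective).symm (Equiv.refl _))).trans
        LeftZeroExtension.equivSum
  let : Monoid X := e.monoid
  let φ : X ≃* LeftZeroExtension A ↥(Set.range f)ᶜ := e.mulEquiv
  refine ⟨fun x => (List.ofFn x).prod, nAryAssociative_prod n, ?_, ?_⟩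
  · rintro x ⟨S, hS, hx⟩
    obtain ⟨i, hi⟩ := LeftZeroExtension.quasitrivialOnD (by omega) hA (φ ∘ x)
      ⟨S, hS, fun i hi j hj => congrArg φ (hx i hi j hj)⟩
    refine ⟨i, φ.injective ?_⟩
    rw [map_list_prod, List.map_ofFn]
    exact hi
  · obtain ⟨m, rfl⟩ : ∃ m, n = m + 2 := ⟨n - 2, by omega⟩
    intro h
    let ψ : A →* X := φ.symm.toMonoidHom.comp LeftZeroExtension.inlHom
    have hψ : Function.Injective ψ :=
      φ.symm.injective.comp LeftZeroExtension.inlHom_injective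
    let g : Fin (m + 2) → A := Fin.cons a (Fin.cons b fun _ => 1)
    obtain ⟨i, hi⟩ := h (ψ ∘ g)
    have hi : g i = a * b := hψ (by
      simpa [g, ← List.map_ofFn, ← map_list_prod] using hi)
    induction i using Fin.cases with
    | zero => exact ha hi.symm
    | succ i =>
      induction i using Fin.cases with
      | zero => exact hb hi.symm
      | succ i => exact h₁ hi.symm

theorem nonempty_embedding_of_natCast_card_le {A X : Type*} [Fintype A]
    (h : (Fintype.card A : Cardinal) ≤ Cardinal.mk X) : Nonempty (A ↪ X) := by
  rw [← Cardinal.lift_mk_le', Cardinal.mk_fintype, Cardinal.lift_natCast]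
  simpa using h

/-- If `n = 3` and `|X| ≥ 4`, or `n ≥ 4` and `|X| ≥ n - 1`, then there is an associative
operation `F : X^n → X` that is quasitrivial on `D^n_{n-1}` but not quasitrivial. -/
theorem stmt_16 {X : Type*} [Nonempty X] (n : ℕ) (hn : 3 ≤ n)
    (hX : (n = 3 ∧ 4 ≤ Cardinal.mk X) ∨
      (4 ≤ n ∧ ((n - 1 : ℕ) : Cardinal) ≤ Cardinal.mk X)) :
    ∃ F : (Fin n → X) → X, NAryAssociative n F ∧
      NAryQuasitrivialOnD n (n - 1) F ∧ ¬NAryQuasitrivial n F := by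
  rcases hX with ⟨rfl, hX⟩ | ⟨hn, hX⟩
  · obtain ⟨f⟩ := nonempty_embedding_of_natCast_card_le
      (A := Multiplicative (ZMod 2 × ZMod 2)) (by simpa using hX)
    exact exists_not_quasitrivial_of_embedding f (by omega) (by decide)
      (a := .ofAdd (1, 0)) (b := .ofAdd (0, 1)) (by decide) (by decide) (by decide)
  · obtain ⟨m, rfl⟩ : ∃ m, n = m + 4 := ⟨n - 4, by omega⟩
    obtain ⟨f⟩ := nonempty_embedding_of_natCast_card_le
      (A := Multiplicative (ZMod (m + 3))) (by simpa [ZMod.card] using hX)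
    have hmod : ∀ k, k ≠ 0 → k < m + 3 → (k : ZMod (m + 3)) ≠ 0 := fun k h₀ hk h =>
      h₀ (Nat.eq_zero_of_dvd_of_lt ((ZMod.natCast_eq_zero_iff _ _).1 h) hk)
    have h₁ : (1 : ZMod (m + 3)) ≠ 0 := by simpa using hmod 1 one_ne_zero (by omega)
    have h₂ : (1 + 1 : ZMod (m + 3)) ≠ 0 := by
      simpa [one_add_one_eq_two] using hmod 2 two_ne_zero (by omega)
    refine exists_not_quasitrivial_of_embedding f (by omega) (fun a => ?_)
      (a := .ofAdd 1) (b := .ofAdd 1) h₂ (mul_ne_left.2 h₁) (mul_ne_left.2 h₁)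
    exact (ofAdd_nsmul (m + 3) a.toAdd).symm.trans (by simp [nsmul_eq_mul])
end
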